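/- Suppose E[ν ln(ν)] = ∞. Then P-almost surely, limsup_{n→∞} (1/n) ln(W∞(ξ_n)) = ln(m), where ξ_n is the spine vertex at generation n. -/

import Mathlib

open MeasureTheory Filter Set

noncomputable section

/-- A configuration assigns to each Ulam–Harris label (a finite word on `ℕ`)
a number of children. A Galton–Watson tree is encoded by such a configuration. -/
abbrev Config : Type := List ℕ → ℕ

/-- `v` is a vertex of the tree encoded by the configuration `ω`:
every step of the path from the root is the index of a child of the previous vertex. -/
def memTree (ω : Config) (v : List ℕ) : Prop :=
  ∀ k, (h : k < v.length) → v.get ⟨k, h⟩ < ω (v.take k)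

/-- `Z ω u k` is the number of descendants of the vertex `u` at height `|u| + k`
in the tree encoded by `ω`. -/
def Z (ω : Config) (u : List ℕ) (k : ℕ) : ℕ :=
  Nat.card {v : List ℕ // v.length = k ∧ memTree ω (u ++ v)}

/-- `GW` is the law of the Galton–Watson tree with offspring distribution `q`:
under `GW` the numbers of children attached to the distinct labels
are i.i.d. with distribution `q`. -/
def IsGW (q : ℕ → ℝ) (GW : Measure Config) : Prop :=
  IsProbabilityMeasure GW ∧
    ∀ (S : Finset (List ℕ)) (g : List ℕ → ℕ),
      GW {ω | ∀ u ∈ S, ω u = g u} = ∏ u ∈ S, ENNReal.ofReal (q (g u))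

/-- The probability generating function `φ_n(x) = E[x^{Z_n}]` of the population
at height `n` under the measure `GW`. -/
def pgf (GW : Measure Config) (n : ℕ) (x : ℝ) : ℝ :=
  ∫ ω, x ^ (Z ω [] n) ∂GW

/-- The vertex at height `n` of the ray whose successive child choices are given by `ξ`. -/
def rayVertex (ξ : ℕ → ℕ) (n : ℕ) : List ℕ := List.ofFn (fun i : Fin n => ξ i)

/-- The generation at height `k` of the tree encoded by `t`. -/
def genSet (t : Config) (k : ℕ) : Set (List ℕ) := {v | v.length = k ∧ memTree t v}

/-- The offspring distribution `q̃_ℓ = q_ℓ e^{1/c_k} e^{-ℓ/c_{k+1}}` of a vertex of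
generation `k` off the spine. -/
def tq (q : ℕ → ℝ) (c : ℕ → ℝ) (k ℓ : ℕ) : ℝ :=
  q ℓ * Real.exp (1 / c k) * Real.exp (-(ℓ : ℝ) / c (k + 1))

/-- The offspring distribution
`q̃^s_ℓ = q_ℓ ℓ e^{-(ℓ-1)/c_{k+1}} φ'_k(φ_k^{-1}(s)) / φ'_{k+1}(φ_{k+1}^{-1}(s))`
of the spine vertex `ξ_k` at generation `k`. -/
def tqs (q : ℕ → ℝ) (c : ℕ → ℝ) (GW : Measure Config) (φinv : ℕ → ℝ → ℝ) (s : ℝ)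
    (k ℓ : ℕ) : ℝ :=
  q ℓ * (ℓ : ℝ) * Real.exp (-((ℓ : ℝ) - 1) / c (k + 1)) *
    (deriv (pgf GW k) (φinv k s) / deriv (pgf GW (k + 1)) (φinv (k + 1) s))

/-- `P` is the law of the marked tree `(𝕋, ξ)` of the spine construction:
conditionally on the first `k` generations `𝕋_k` and on the spine vertex `ξ_k`, the
numbers of children of the vertices at generation `k` are independent, the spine vertex
`ξ_k` having `ℓ` children with probability `tqs k ℓ`, every other vertex of generation `k`
having `ℓ` children with probability `tq k ℓ`, and `ξ_{k+1}` is chosen uniformly among the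
children of `ξ_k`.  Equivalently, the probability that the tree agrees with `t` up to
generation `n` and that the spine makes the choices `u 0, …, u (n-1)` is the product below. -/
def IsSpineLaw (tq' tqs' : ℕ → ℕ → ℝ) (P : Measure (Config × (ℕ → ℕ))) : Prop :=
  IsProbabilityMeasure P ∧
    ∀ (n : ℕ) (t : Config) (u : ℕ → ℕ), (∀ k < n, u k < t (rayVertex u k)) →
      P {p | (∀ v : List ℕ, v.length < n → memTree t v → p.1 v = t v) ∧
             (∀ k < n, p.2 k = u k)}
        = ∏ k ∈ Finset.range n,
            ENNReal.ofReal ((tqs' k (t (rayVertex u k)) / (t (rayVertex u k)))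
              * ∏ᶠ v ∈ (genSet t k \ {rayVertex u k}), tq' k (t v))

section helpers
open MeasureTheory Filter Set
/-- Descendants of `u` after `k` generations. -/
def Gen (ω : Config) (u : List ℕ) : ℕ → Finset (List ℕ)
  | 0 => {u}
  | k + 1 => (Gen ω u k).biUnion (fun v => (Finset.range (ω v)).image (fun i => v ++ [i]))

lemma memTree_nil (ω : Config) : memTree ω [] := by
  intro k h; simp at h

lemma memTree_append_singleton (ω : Config) (v : List ℕ) (i : ℕ) :
    memTree ω (v ++ [i]) ↔ memTree ω v ∧ i < ω v := by
  unfold memTree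
  constructor
  · intro h
    refine ⟨fun k hk => ?_, ?_⟩
    · have := h k (by simp; omega)
      simpa [List.getElem_append, hk, List.take_append_of_le_length hk.le] using this
    · have := h v.length (by simp)
      simpa using this
  · rintro ⟨h1, h2⟩ k hk
    simp at hk
    rcases Nat.lt_or_ge k v.length with h | h
    · have := h1 k h
      simpa [List.getElem_append, h, List.take_append_of_le_length h.le] using this
    · have : k = v.length := by omega
      subst this
      simpa using h2

lemma memTree_of_append (ω : Config) (u v : List ℕ) (h : memTree ω (u ++ v)) : memTree ω u := by
  induction v using List.reverseRecOn with
  | nil => simpa using h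
  | append_singleton v i ih =>
    rw [← List.append_assoc, memTree_append_singleton] at h
    exact ih h.1

lemma mem_Gen (ω : Config) (u : List ℕ) (hu : memTree ω u) (k : ℕ) (w : List ℕ) :
    w ∈ Gen ω u k ↔ ∃ v, w = u ++ v ∧ v.length = k ∧ memTree ω w := by
  induction k generalizing w with
  | zero =>
    simp only [Gen, Finset.mem_singleton, List.length_eq_zero_iff]
    constructor
    · rintro rfl; exact ⟨[], by simp, rfl, hu⟩
    · rintro ⟨v, h, rfl, _⟩; simpa using h
  | succ k ih =>
    simp only [Gen, Finset.mem_biUnion, Finset.mem_image, Finset.mem_range]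
    constructor
    · rintro ⟨a, ha, i, hi, rfl⟩
      obtain ⟨v, rfl, hv, ht⟩ := (ih a).1 ha
      exact ⟨v ++ [i], by simp, by simp [hv], (memTree_append_singleton ..).2 ⟨ht, hi⟩⟩
    · rintro ⟨v, rfl, hv, ht⟩
      induction v using List.reverseRecOn with
      | nil => simp at hv
      | append_singleton v i _ =>
        rw [← List.append_assoc, memTree_append_singleton] at ht
        exact ⟨u ++ v, (ih _).2 ⟨v, rfl, by simpa using hv, ht.1⟩, i, ht.2, by simp⟩

lemma card_Gen_succ (ω : Config) (u : List ℕ) (k : ℕ) :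
    (Gen ω u (k + 1)).card = ∑ v ∈ Gen ω u k, ω v := by
  rw [Gen, Finset.card_biUnion]
  · refine Finset.sum_congr rfl fun v _ => ?_
    rw [Finset.card_image_of_injective _ (fun i j h => by simpa using h), Finset.card_range]
  · intro v _ w _ hvw
    rw [Function.onFun, Finset.disjoint_left]
    rintro a ha hb
    simp only [Finset.mem_image] at ha hb
    obtain ⟨i, _, rfl⟩ := ha
    obtain ⟨j, _, h⟩ := hb
    have := List.append_inj_left' h rfl
    exact hvw this.symm

lemma Z_eq_card (ω : Config) (u : List ℕ) (hu : memTree ω u) (k : ℕ) :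
    Z ω u k = (Gen ω u k).card := by
  unfold Z
  rw [← Fintype.card_coe, ← Nat.card_eq_fintype_card]
  refine Nat.card_congr (Equiv.ofBijective
    (fun v => ⟨u ++ v.1, (mem_Gen ω u hu k _).2 ⟨v.1, rfl, v.2.1, v.2.2⟩⟩) ⟨?_, ?_⟩)
  · rintro ⟨v, _⟩ ⟨w, _⟩ h
    simpa using h
  · rintro ⟨w, hw⟩
    obtain ⟨v, rfl, hv, ht⟩ := (mem_Gen ω u hu k _).1 hw
    exact ⟨⟨v, hv, ht⟩, rfl⟩

lemma mem_Gen_nil (ω : Config) (k : ℕ) (w : List ℕ) :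
    w ∈ Gen ω [] k ↔ w.length = k ∧ memTree ω w := by
  rw [mem_Gen ω [] (memTree_nil ω)]
  simp

lemma Gen_subset (ω : Config) (u : List ℕ) (hu : memTree ω u) (k : ℕ) :
    Gen ω u k ⊆ Gen ω [] (u.length + k) := by
  intro w hw
  obtain ⟨v, rfl, hv, ht⟩ := (mem_Gen ω u hu k _).1 hw
  exact (mem_Gen_nil ..).2 ⟨by simp [hv], ht⟩

lemma genSet_eq (ω : Config) (k : ℕ) : genSet ω k = (Gen ω [] k : Set (List ℕ)) := by
  ext w; simp [genSet, mem_Gen_nil]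

lemma rayVertex_succ (ξ : ℕ → ℕ) (n : ℕ) : rayVertex ξ (n + 1) = rayVertex ξ n ++ [ξ n] := by
  unfold rayVertex
  rw [List.ofFn_succ_last]; simp

lemma rayVertex_length (ξ : ℕ → ℕ) (n : ℕ) : (rayVertex ξ n).length = n := by simp [rayVertex]

lemma rayVertex_congr {ξ ξ' : ℕ → ℕ} (n : ℕ) (h : ∀ k < n, ξ k = ξ' k) :
    rayVertex ξ n = rayVertex ξ' n := by
  induction n with
  | zero => simp [rayVertex]
  | succ n ih => rw [rayVertex_succ, rayVertex_succ, ih (fun k hk => h k (by omega)), h n (by omega)]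

/-- the marked tree space -/
abbrev Om : Type := Config × (ℕ → ℕ)

/-- valid spine up to level n -/
def Valid (n : ℕ) (p : Om) : Prop := ∀ k < n, p.2 k < p.1 (rayVertex p.2 k)

lemma Valid.mem {n : ℕ} {p : Om} (h : Valid n p) : ∀ k ≤ n, memTree p.1 (rayVertex p.2 k) := by
  intro k hk
  induction k with
  | zero => simpa [rayVertex] using memTree_nil p.1
  | succ k ih => rw [rayVertex_succ, memTree_append_singleton]; exact ⟨ih (by omega), h k (by omega)⟩

/-- The ray from n continued to n+k is a descendant. -/
lemma Valid.mem_gen {n k : ℕ} {p : Om} (h : Valid (n + k) p) :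
    rayVertex p.2 (n + k) ∈ Gen p.1 (rayVertex p.2 n) k := by
  induction k with
  | zero => simp [Gen]
  | succ k ih =>
    have := ih (fun j hj => h j (by omega))
    simp only [Gen, Finset.mem_biUnion, Finset.mem_image, Finset.mem_range]
    exact ⟨_, this, p.2 (n + k), h (n + k) (by omega), by rw [← rayVertex_succ]; rfl⟩

/-- atoms -/
def Atom (n : ℕ) (p : Om) : Set Om :=
  {p' | (∀ v : List ℕ, v.length < n → memTree p.1 v → p'.1 v = p.1 v) ∧ (∀ k < n, p'.2 k = p.2 k)}

lemma Atom.self (n : ℕ) (p : Om) : p ∈ Atom n p := ⟨fun _ _ _ => rfl, fun _ _ => rfl⟩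

lemma memTree_of_agree {ω ω' : Config} {n : ℕ}
    (h : ∀ v : List ℕ, v.length < n → memTree ω v → ω' v = ω v) (v : List ℕ) (hv : v.length ≤ n) :
    memTree ω' v ↔ memTree ω v := by
  induction v using List.reverseRecOn with
  | nil => simp [memTree_nil]
  | append_singleton v i ih =>
    simp at hv
    rw [memTree_append_singleton, memTree_append_singleton, ih (by omega)]
    refine and_congr_right fun hm => by rw [h v (by omega) hm]

lemma Atom.mtree {n : ℕ} {p p' : Om} (h : p' ∈ Atom n p) (v : List ℕ) (hv : v.length ≤ n) :
    memTree p'.1 v ↔ memTree p.1 v := memTree_of_agree h.1 v hv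

lemma Atom.symm {n : ℕ} {p p' : Om} (h : p' ∈ Atom n p) : p ∈ Atom n p' :=
  ⟨fun v hv hm => (h.1 v hv ((Atom.mtree h v hv.le).1 hm)).symm, fun k hk => (h.2 k hk).symm⟩

lemma Atom.ray {n : ℕ} {p p' : Om} (h : p' ∈ Atom n p) (k : ℕ) (hk : k ≤ n) :
    rayVertex p'.2 k = rayVertex p.2 k := rayVertex_congr k (fun j hj => h.2 j (by omega))

lemma Atom.gen {n : ℕ} {p p' : Om} (h : p' ∈ Atom n p) (u : List ℕ) (hu : memTree p.1 u) (k : ℕ)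
    (hk : u.length + k ≤ n) : Gen p'.1 u k = Gen p.1 u k := by
  ext w
  rw [mem_Gen _ _ ((Atom.mtree h u (by omega)).2 hu), mem_Gen _ _ hu]
  constructor
  · rintro ⟨v, rfl, hv, ht⟩
    exact ⟨v, rfl, hv, (Atom.mtree h _ (by simp; omega)).1 ht⟩
  · rintro ⟨v, rfl, hv, ht⟩
    exact ⟨v, rfl, hv, (Atom.mtree h _ (by simp; omega)).2 ht⟩

lemma Atom.valid {n : ℕ} {p p' : Om} (h : p' ∈ Atom n p) (hv : Valid n p) : Valid n p' := by
  intro k hk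
  rw [h.2 k hk, Atom.ray h k hk.le, h.1 _ (by rw [rayVertex_length]; exact hk) (hv.mem k hk.le)]
  exact hv k hk

/-- level-n code -/
def code (n : ℕ) (p : Om) : Finset (List ℕ × ℕ) × List ℕ :=
  (((Finset.range n).biUnion (fun k => Gen p.1 [] k)).image (fun v => (v, p.1 v)), rayVertex p.2 n)

lemma code_eq_iff (n : ℕ) (p p' : Om) : code n p' = code n p ↔ p' ∈ Atom n p := by
  constructor
  · intro h
    have h1 := congrArg Prod.fst h
    have h2 := congrArg Prod.snd h
    simp only [code] at h1 h2
    refine ⟨fun v hv hm => ?_, fun k hk => ?_⟩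
    · have : (v, p.1 v) ∈ ((Finset.range n).biUnion (fun k => Gen p'.1 [] k)).image
          (fun v => (v, p'.1 v)) := by
        rw [h1]
        refine Finset.mem_image.2 ⟨v, ?_, rfl⟩
        simp only [Finset.mem_biUnion, Finset.mem_range, mem_Gen_nil]
        exact ⟨_, hv, rfl, hm⟩
      obtain ⟨w, _, hw⟩ := Finset.mem_image.1 this
      simp only [Prod.mk.injEq] at hw
      obtain ⟨rfl, h⟩ := hw
      exact h
    · have := congrArg (fun l : List ℕ => l[k]?) h2
      simpa [rayVertex, hk] using this
  · intro h
    unfold code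
    rw [Atom.ray h n le_rfl]
    congr 1
    have : (Finset.range n).biUnion (fun k => Gen p'.1 [] k) =
        (Finset.range n).biUnion (fun k => Gen p.1 [] k) := by
      refine Finset.biUnion_congr rfl fun k hk => ?_
      exact Atom.gen h [] (memTree_nil _) k (by simpa using (Finset.mem_range.1 hk).le)
    rw [this]
    refine Finset.image_congr fun v hv => ?_
    simp only [Finset.coe_biUnion, Finset.coe_range, Set.mem_iUnion, Set.mem_Iio, Finset.mem_coe,
      mem_Gen_nil] at hv
    obtain ⟨k, hk, h3, h4⟩ := hv
    simp only [h.1 v (by omega) h4]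

lemma measurableSet_Atom (n : ℕ) (p : Om) : MeasurableSet (Atom n p) := by
  have : Atom n p = (⋂ v : List ℕ, ⋂ (_ : v.length < n), ⋂ (_ : memTree p.1 v),
      (fun q : Om => q.1 v) ⁻¹' {p.1 v}) ∩ ⋂ k : ℕ, ⋂ (_ : k < n), (fun q : Om => q.2 k) ⁻¹' {p.2 k} := by
    ext q; simp [Atom]
  rw [this]
  refine MeasurableSet.inter ?_ ?_
  · refine MeasurableSet.iInter fun v => MeasurableSet.iInter fun _ => MeasurableSet.iInter fun _ => ?_
    exact (measurableSet_singleton _).preimage (by fun_prop)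
  · refine MeasurableSet.iInter fun v => MeasurableSet.iInter fun _ => ?_
    exact (measurableSet_singleton _).preimage (by fun_prop)

lemma measurableSet_code (n : ℕ) (a) : MeasurableSet (code n ⁻¹' {a}) := by
  rcases (code n ⁻¹' {a}).eq_empty_or_nonempty with h | ⟨p, hp⟩
  · rw [h]; exact MeasurableSet.empty
  · have : code n ⁻¹' {a} = Atom n p := by
      ext p'
      rw [← code_eq_iff]
      simp only [Set.mem_preimage, Set.mem_singleton_iff] at hp ⊢
      rw [hp]
    rw [this]; exact measurableSet_Atom n p

/-- A function determined by level-n atoms is measurable. -/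
lemma measurable_of_atom {β : Type*} [MeasurableSpace β] (n : ℕ) (F : Om → β)
    (h : ∀ p p', p' ∈ Atom n p → F p' = F p) : Measurable F := by
  intro s _
  have : F ⁻¹' s = ⋃ a ∈ code n '' (F ⁻¹' s), code n ⁻¹' {a} := by
    ext p
    simp only [Set.mem_preimage, Set.mem_image, Set.mem_iUnion, Set.mem_singleton_iff, exists_prop]
    constructor
    · intro hp; exact ⟨_, ⟨p, hp, rfl⟩, rfl⟩
    · rintro ⟨_, ⟨p', hp', rfl⟩, h2⟩
      rw [h p' p ((code_eq_iff ..).1 h2)]; exact hp'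
  rw [this]
  exact MeasurableSet.biUnion (Set.to_countable _) fun a _ => measurableSet_code n a

lemma lintegral_code (μ : Measure Om) (n : ℕ) (F : Om → ENNReal) :
    ∫⁻ p, F p ∂μ = ∑' a, ∫⁻ p in code n ⁻¹' {a}, F p ∂μ := by
  rw [← lintegral_iUnion (fun a => measurableSet_code n a)]
  · have : ⋃ a, code n ⁻¹' {a} = Set.univ := by ext p; simp
    rw [this, Measure.restrict_univ]
  · intro a b hab
    rw [Function.onFun, Set.disjoint_left]
    intro p h1 h2
    exact hab (h1.symm.trans h2)

lemma decomp (μ : Measure Om) (n : ℕ) (Q : Om → Prop) (hQ : ∀ᵐ p ∂μ, Q p) (F G : Om → ENNReal)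
    (h : ∀ p, Q p → ∫⁻ p' in Atom n p, F p' ∂μ ≤ ∫⁻ p' in Atom n p, G p' ∂μ) :
    ∫⁻ p, F p ∂μ ≤ ∫⁻ p, G p ∂μ := by
  rw [lintegral_code μ n F, lintegral_code μ n G]
  refine ENNReal.tsum_le_tsum fun a => ?_
  by_cases hp : ∃ p, Q p ∧ code n p = a
  · obtain ⟨p, hp, rfl⟩ := hp
    have : code n ⁻¹' {code n p} = Atom n p := by
      ext p'; rw [← code_eq_iff]; simp
    rw [this]; exact h p hp
  · have : μ (code n ⁻¹' {a}) = 0 := by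
      refine measure_mono_null ?_ hQ
      intro p h1 h2
      exact hp ⟨p, h2, h1⟩
    rw [Measure.restrict_eq_zero.2 this]; simp

/-- Null sets can be checked on atoms. -/
lemma ae_of_atoms (μ : Measure Om) (n : ℕ) (Q R : Om → Prop) (hQ : ∀ᵐ p ∂μ, Q p)
    (h : ∀ p, Q p → μ (Atom n p ∩ {p' | ¬ R p'}) = 0) : ∀ᵐ p ∂μ, R p := by
  have : {p | ¬ R p} ⊆ {p | ¬ Q p} ∪ ⋃ a ∈ code n '' {p | Q p}, (code n ⁻¹' {a} ∩ {p' | ¬ R p'}) := by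
    intro p hp
    by_cases hq : Q p
    · right
      simp only [Set.mem_iUnion]
      exact ⟨code n p, ⟨p, hq, rfl⟩, rfl, hp⟩
    · left; exact hq
  refine measure_mono_null this (measure_union_null hQ ?_)
  rw [measure_biUnion_null_iff (Set.to_countable _)]
  rintro _ ⟨p, hp, rfl⟩
  have : code n ⁻¹' {code n p} = Atom n p := by
    ext p'; rw [← code_eq_iff]; simp
  rw [this]; exact h p hp

lemma prod_lintegral (μ : Measure Om) (S : Finset (List ℕ)) (π h : List ℕ → ℕ → ENNReal) :
    ∀ (A : Set Om) (K : ENNReal), MeasurableSet A →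
    (∀ g : List ℕ → ℕ, μ (A ∩ {p | ∀ v ∈ S, p.1 v = g v}) = K * ∏ v ∈ S, π v (g v)) →
    ∫⁻ p in A, ∏ v ∈ S, h v (p.1 v) ∂μ = K * ∏ v ∈ S, ∑' ℓ, π v ℓ * h v ℓ := by
  induction S using Finset.induction_on with
  | empty => intro A K hA H; simpa using H 0
  | insert v S hv ih =>
    intro A K hA H
    have hm : ∀ ℓ, MeasurableSet (A ∩ {p : Om | p.1 v = ℓ}) := fun ℓ =>
      hA.inter ((measurableSet_singleton ℓ).preimage (f := fun p : Om => p.1 v) (by fun_prop))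
    have hA' : A = ⋃ ℓ : ℕ, (A ∩ {p : Om | p.1 v = ℓ}) := by ext p; simp
    have h1 : ∀ ℓ, ∫⁻ p in A ∩ {p : Om | p.1 v = ℓ}, ∏ v ∈ insert v S, h v (p.1 v) ∂μ
        = K * (π v ℓ * h v ℓ) * ∏ v ∈ S, ∑' ℓ, π v ℓ * h v ℓ := by
      intro ℓ
      have h2 : ∫⁻ p in A ∩ {p : Om | p.1 v = ℓ}, ∏ v ∈ insert v S, h v (p.1 v) ∂μ
          = ∫⁻ p in A ∩ {p : Om | p.1 v = ℓ}, h v ℓ * ∏ v ∈ S, h v (p.1 v) ∂μ := by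
        refine setLIntegral_congr_fun (hm ℓ) fun p hp => ?_
        have : p.1 v = ℓ := hp.2
        simp only [Finset.prod_insert hv, this]
      rw [h2, lintegral_const_mul]
      · rw [ih (A ∩ {p : Om | p.1 v = ℓ}) (K * π v ℓ) (hm ℓ)]
        · ring
        · intro g
          have := H (Function.update g v ℓ)
          rw [Finset.prod_insert hv] at this
          simp only [Function.update_self] at this
          have h3 : A ∩ {p : Om | p.1 v = ℓ} ∩ {p : Om | ∀ w ∈ S, p.1 w = g w} =
              A ∩ {p | ∀ w ∈ insert v S, p.1 w = Function.update g v ℓ w} := by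
            ext p
            simp only [Set.mem_inter_iff, Set.mem_ofPred_eq, Finset.mem_insert, forall_eq_or_imp,
              Function.update_self, and_assoc]
            refine and_congr_right fun _ => and_congr_right fun _ => ?_
            refine forall₂_congr fun w hw => ?_
            rw [Function.update_of_ne (by rintro rfl; exact hv hw)]
          rw [h3, this, mul_assoc]
          congr 2
          refine Finset.prod_congr rfl fun w hw => ?_
          rw [Function.update_of_ne (by rintro rfl; exact hv hw)]
      · exact Finset.measurable_prod _ fun w _ =>
          (measurable_of_countable (h w)).comp (by fun_prop)
    conv_lhs => rw [hA']
    rw [lintegral_iUnion hm]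
    · simp_rw [h1]
      rw [Finset.prod_insert hv, ENNReal.tsum_mul_right, ENNReal.tsum_mul_left]
      ring
    · intro i j hij
      rw [Function.onFun, Set.disjoint_left]
      rintro p ⟨_, h1⟩ ⟨_, h2⟩
      exact hij (h1.symm.trans h2)

section spine
variable (a b : ℕ → ℕ → ℝ) (ha : ∀ k ℓ, 0 ≤ a k ℓ) (hb : ∀ k ℓ, 0 ≤ b k ℓ) (hb0 : ∀ k, b k 0 = 0)
  (has : ∀ k, ∑' ℓ, ENNReal.ofReal (a k ℓ) = 1) (hbs : ∀ k, ∑' ℓ, ENNReal.ofReal (b k ℓ) = 1)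
  (P : Measure Om) (hP : IsSpineLaw a b P)

/-- one-step law -/
def stepLaw (a b : ℕ → ℕ → ℝ) (j : ℕ) (r : List ℕ) (v : List ℕ) (ℓ : ℕ) : ENNReal :=
  if v = r then ENNReal.ofReal (b j ℓ) else ENNReal.ofReal (a j ℓ)

/-- extension of a configuration -/
def ext1 (p : Om) (j : ℕ) (g : Config) (i : ℕ) : Om :=
  (fun v => if v.length < j then p.1 v else g v, fun k => if k < j then p.2 k else i)

lemma ext1_mem (p : Om) (j : ℕ) (g : Config) (i : ℕ) : ext1 p j g i ∈ Atom j p := by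
  refine ⟨fun v hv _ => by simp [ext1, hv], fun k hk => by simp [ext1, hk]⟩

include hP in
lemma atom_mass (n : ℕ) (p : Om) (hv : Valid n p) : P (Atom n p) = ∏ k ∈ Finset.range n,
    ENNReal.ofReal ((b k (p.1 (rayVertex p.2 k)) / (p.1 (rayVertex p.2 k)))
              * ∏ᶠ v ∈ (genSet p.1 k \ {rayVertex p.2 k}), a k (p.1 v)) :=
  hP.2 n p.1 p.2 hv

lemma step_factor (ha : ∀ k ℓ, 0 ≤ a k ℓ) (hb : ∀ k ℓ, 0 ≤ b k ℓ) (hb0 : ∀ k, b k 0 = 0)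
    (j : ℕ) (S : Finset (List ℕ)) (r : List ℕ) (hr : r ∈ S) (g : Config) :
    (g r : ENNReal) * ENNReal.ofReal ((b j (g r) / (g r)) * ∏ᶠ v ∈ ((S : Set (List ℕ)) \ {r}), a j (g v))
      = ∏ v ∈ S, stepLaw a b j r v (g v) := by
  have h1 : ∏ᶠ v ∈ ((S : Set (List ℕ)) \ {r}), a j (g v) = ∏ v ∈ S.erase r, a j (g v) := by
    rw [← Finset.coe_erase, finprod_mem_coe_finset]
  rw [h1, ← Finset.mul_prod_erase _ _ hr, ENNReal.ofReal_mul (div_nonneg (hb _ _) (Nat.cast_nonneg _)),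
    ENNReal.ofReal_prod_of_nonneg (fun _ _ => ha _ _), ← mul_assoc]
  congr 1
  · simp only [stepLaw, if_true]
    rcases Nat.eq_zero_or_pos (g r) with h | h
    · simp [h, hb0]
    · rw [← ENNReal.ofReal_natCast, ← ENNReal.ofReal_mul (Nat.cast_nonneg _)]
      congr 1
      have : (g r : ℝ) ≠ 0 := by positivity
      field_simp
  · refine Finset.prod_congr rfl fun v hv => ?_
    simp [stepLaw, Finset.ne_of_mem_erase hv]

include ha hb hb0 hP in
lemma step_mass (j : ℕ) (p : Om) (hv : Valid j p) (g : Config) :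
    P ((Atom j p ∩ {p' | p'.2 j < p'.1 (rayVertex p'.2 j)}) ∩
      {p' | ∀ v ∈ Gen p.1 [] j, p'.1 v = g v}) =
    P (Atom j p) * ∏ v ∈ Gen p.1 [] j, stepLaw a b j (rayVertex p.2 j) v (g v) := by
  have hr : rayVertex p.2 j ∈ Gen p.1 [] j :=
    (mem_Gen_nil ..).2 ⟨rayVertex_length _ _, hv.mem j le_rfl⟩
  set r := rayVertex p.2 j with hrdef
  have hrl : r.length = j := rayVertex_length _ _
  have hset : (Atom j p ∩ {p' | p'.2 j < p'.1 (rayVertex p'.2 j)}) ∩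
      {p' | ∀ v ∈ Gen p.1 [] j, p'.1 v = g v} =
      ⋃ i ∈ Finset.range (g r), Atom (j + 1) (ext1 p j g i) := by
    ext p'
    simp only [Set.mem_inter_iff, Set.mem_ofPred_eq, Set.mem_iUnion, Finset.mem_range, exists_prop]
    constructor
    · rintro ⟨⟨h1, h2⟩, h3⟩
      have h4 : p'.1 r = g r := h3 r hr
      rw [Atom.ray h1 j le_rfl, ← hrdef, h4] at h2
      refine ⟨p'.2 j, h2, fun v hvl hvm => ?_, fun k hk => ?_⟩
      · rw [Atom.mtree (ext1_mem p j g _) v (by omega)] at hvm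
        by_cases h : v.length < j
        · simpa [ext1, h] using h1.1 v h hvm
        · simpa [ext1, h] using h3 v ((mem_Gen_nil ..).2 ⟨by omega, hvm⟩)
      · by_cases h : k < j
        · simpa [ext1, h] using h1.2 k h
        · have : k = j := by omega
          subst this; simp [ext1]
    · rintro ⟨i, hi, h⟩
      have h1 : p' ∈ Atom j p := by
        refine ⟨fun v hvl hvm => ?_, fun k hk => ?_⟩
        · rw [h.1 v (by omega) ((Atom.mtree (ext1_mem p j g i) v hvl.le).2 hvm)]; simp [ext1, hvl]
        · rw [h.2 k (by omega)]; simp [ext1, hk]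
      have h3 : ∀ v ∈ Gen p.1 [] j, p'.1 v = g v := by
        intro v hvm
        rw [mem_Gen_nil] at hvm
        rw [h.1 v (by omega) ((Atom.mtree (ext1_mem p j g i) v hvm.1.le).2 hvm.2)]; simp [ext1, hvm.1]
      refine ⟨⟨h1, ?_⟩, h3⟩
      rw [Atom.ray h1 j le_rfl, ← hrdef, h3 r hr, h.2 j (by omega)]
      simpa [ext1] using hi
  rw [hset, measure_biUnion_finset]
  · have : ∀ i ∈ Finset.range (g r), P (Atom (j + 1) (ext1 p j g i)) = P (Atom j p) *
        ENNReal.ofReal ((b j (g r) / (g r)) * ∏ᶠ v ∈ ((Gen p.1 [] j : Set (List ℕ)) \ {r}), a j (g v)) := by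
      intro i hi
      have hm := ext1_mem p j g i
      have hray := fun k (hk : k ≤ j) => Atom.ray hm k hk
      have hgr : (ext1 p j g i).1 r = g r := by simp [ext1, hrl]
      have hv' : Valid (j + 1) (ext1 p j g i) := by
        intro k hk
        rcases Nat.lt_succ_iff_lt_or_eq.1 hk with h | rfl
        · exact Atom.valid hm hv k h
        · rw [hray k le_rfl, ← hrdef, hgr]; simpa [ext1] using hi
      rw [atom_mass a b P hP _ _ hv', atom_mass a b P hP _ _ hv, Finset.prod_range_succ]
      congr 1
      · refine Finset.prod_congr rfl fun k hk => ?_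
        have hk' := Finset.mem_range.1 hk
        rw [hray k hk'.le, hm.1 _ (by rw [rayVertex_length]; exact hk') (hv.mem k hk'.le)]
        congr 2
        rw [genSet_eq, genSet_eq, Atom.gen hm [] (memTree_nil _) k (by simp; omega)]
        refine finprod_mem_congr rfl fun v hvm => ?_
        have := (mem_Gen_nil ..).1 hvm.1
        rw [hm.1 v (by omega) this.2]
      · rw [hray j le_rfl, ← hrdef, hgr, genSet_eq, Atom.gen hm [] (memTree_nil _) j (by simp)]
        congr 2
        refine finprod_mem_congr rfl fun v hvm => ?_
        have := (mem_Gen_nil ..).1 hvm.1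
        simp [ext1, this.1]
    rw [Finset.sum_congr rfl this, Finset.sum_const, Finset.card_range, nsmul_eq_mul,
      ← step_factor a b ha hb hb0 j _ r hr g]
    ring
  · intro i _ i' _ hii
    rw [Function.onFun, Set.disjoint_left]
    intro p' h1 h2
    have e1 := h1.2 j (by omega)
    have e2 := h2.2 j (by omega)
    simp [ext1] at e1 e2
    exact hii (e1.symm.trans e2)
  · intro i _; exact measurableSet_Atom _ _

lemma measurable_L (j : ℕ) : Measurable (fun p : Om => p.1 (rayVertex p.2 j)) := by
  refine measurable_to_countable' fun ℓ => ?_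
  have : (fun p : Om => p.1 (rayVertex p.2 j)) ⁻¹' {ℓ} =
      ⋃ v : List ℕ, ({p : Om | rayVertex p.2 j = v} ∩ {p : Om | p.1 v = ℓ}) := by
    ext p; simp
  rw [this]
  refine MeasurableSet.iUnion fun v => MeasurableSet.inter ?_ ?_
  · let _ : MeasurableSpace (List ℕ) := ⊤
    exact measurable_of_atom j (fun p : Om => rayVertex p.2 j)
      (fun p p' h => Atom.ray h j le_rfl) (t := {v}) trivial
  · exact (measurableSet_singleton ℓ).preimage (f := fun p : Om => p.1 v) (by fun_prop)

lemma measurableSet_validstep (j : ℕ) :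
    MeasurableSet {p' : Om | p'.2 j < p'.1 (rayVertex p'.2 j)} :=
  measurableSet_lt (by fun_prop) (measurable_L j)

lemma stepLaw_sum (has : ∀ k, ∑' ℓ, ENNReal.ofReal (a k ℓ) = 1)
    (hbs : ∀ k, ∑' ℓ, ENNReal.ofReal (b k ℓ) = 1) (j : ℕ) (r v : List ℕ) :
    ∑' ℓ, stepLaw a b j r v ℓ = 1 := by
  unfold stepLaw
  split_ifs
  · exact hbs j
  · exact has j

include ha hb hb0 has hbs hP in
lemma step_valid (j : ℕ) (p : Om) (hv : Valid j p) :
    P (Atom j p ∩ {p' | ¬ p'.2 j < p'.1 (rayVertex p'.2 j)}) = 0 := by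
  have := hP.1
  have h := prod_lintegral P (Gen p.1 [] j) (stepLaw a b j (rayVertex p.2 j)) (fun _ _ => 1)
    (Atom j p ∩ {p' | p'.2 j < p'.1 (rayVertex p'.2 j)}) (P (Atom j p))
    ((measurableSet_Atom j p).inter (measurableSet_validstep j)) (step_mass a b ha hb hb0 P hP j p hv)
  simp only [mul_one, stepLaw_sum a b has hbs, Finset.prod_const_one, lintegral_const,
    Measure.restrict_apply MeasurableSet.univ, Set.univ_inter, one_mul] at h
  have h2 := measure_inter_add_sdiff (μ := P) (Atom j p) (measurableSet_validstep j)
  rw [h] at h2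
  have h3 : P (Atom j p \ {p' : Om | p'.2 j < p'.1 (rayVertex p'.2 j)}) = 0 := by
    have hne : P (Atom j p) ≠ ⊤ := measure_ne_top _ _
    exact (ENNReal.add_right_inj hne).1 (by rw [h2, add_zero])
  exact h3

include ha hb hb0 has hbs hP in
lemma ae_valid : ∀ᵐ p ∂P, ∀ n, Valid n p := by
  rw [ae_all_iff]
  intro n
  induction n with
  | zero => exact ae_of_all _ fun p k hk => by omega
  | succ n ih =>
    have := ae_of_atoms P n (Valid n) (fun p => p.2 n < p.1 (rayVertex p.2 n)) ih
      (fun p hp => step_valid a b ha hb hb0 has hbs P hP n p hp)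
    filter_upwards [ih, this] with p h1 h2 k hk
    rcases Nat.lt_succ_iff_lt_or_eq.1 hk with h | rfl
    · exact h1 k h
    · exact h2

include ha hb hb0 has hbs hP in
lemma step_lintegral (j : ℕ) (p : Om) (hv : Valid j p) (h : List ℕ → ℕ → ENNReal) :
    ∫⁻ p' in Atom j p, ∏ v ∈ Gen p.1 [] j, h v (p'.1 v) ∂P =
      P (Atom j p) * ∏ v ∈ Gen p.1 [] j, ∑' ℓ, stepLaw a b j (rayVertex p.2 j) v ℓ * h v ℓ := by
  rw [← prod_lintegral P (Gen p.1 [] j) (stepLaw a b j (rayVertex p.2 j)) h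
    (Atom j p ∩ {p' | p'.2 j < p'.1 (rayVertex p'.2 j)}) (P (Atom j p))
    ((measurableSet_Atom j p).inter (measurableSet_validstep j)) (step_mass a b ha hb hb0 P hP j p hv)]
  refine (setLIntegral_congr ?_).symm
  have h0 := step_valid a b ha hb hb0 has hbs P hP j p hv
  have h1 : ∀ᵐ q ∂P, ¬ (q ∈ Atom j p ∩ {p' | ¬ p'.2 j < p'.1 (rayVertex p'.2 j)}) :=
    measure_eq_zero_iff_ae_notMem.1 h0
  filter_upwards [h1] with q hq
  apply propext
  change (q ∈ Atom j p ∩ _) ↔ q ∈ Atom j p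
  constructor
  · exact fun h => h.1
  · intro h
    refine ⟨h, ?_⟩
    by_contra h2
    exact hq ⟨h, h2⟩

/-- law of the spine offspring -/
lemma spine_L (ha : ∀ k ℓ, 0 ≤ a k ℓ) (hb : ∀ k ℓ, 0 ≤ b k ℓ) (hb0 : ∀ k, b k 0 = 0)
    (has : ∀ k, ∑' ℓ, ENNReal.ofReal (a k ℓ) = 1) (hbs : ∀ k, ∑' ℓ, ENNReal.ofReal (b k ℓ) = 1)
    (P : Measure Om) (hP : IsSpineLaw a b P)
    (j : ℕ) (F : Om → ENNReal) (hF : ∀ p p', p' ∈ Atom j p → F p' = F p) (H : ℕ → ENNReal) :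
    ∫⁻ p, F p * H (p.1 (rayVertex p.2 j)) ∂P ≤
      ∫⁻ p, F p * ∑' ℓ, ENNReal.ofReal (b j ℓ) * H ℓ ∂P := by
  refine decomp P j (Valid j) ((ae_all_iff.1 (ae_valid a b ha hb hb0 has hbs P hP)) j) _ _ ?_
  intro p hv
  have hr : rayVertex p.2 j ∈ Gen p.1 [] j :=
    (mem_Gen_nil ..).2 ⟨rayVertex_length _ _, hv.mem j le_rfl⟩
  let h : List ℕ → ℕ → ENNReal := fun v ℓ => if v = rayVertex p.2 j then H ℓ else 1
  have h1 : ∫⁻ p' in Atom j p, F p' * H (p'.1 (rayVertex p'.2 j)) ∂P =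
      ∫⁻ p' in Atom j p, F p * ∏ v ∈ Gen p.1 [] j,
        h v (p'.1 v) ∂P := by
    refine setLIntegral_congr_fun (measurableSet_Atom j p) fun p' hp' => ?_
    simp only [h]
    rw [hF p p' hp', Atom.ray hp' j le_rfl, Finset.prod_ite_eq' , if_pos hr]
  have h2 : ∫⁻ p' in Atom j p, F p' * ∑' ℓ, ENNReal.ofReal (b j ℓ) * H ℓ ∂P =
      ∫⁻ p' in Atom j p, F p * ∑' ℓ, ENNReal.ofReal (b j ℓ) * H ℓ ∂P := by
    refine setLIntegral_congr_fun (measurableSet_Atom j p) fun p' hp' => ?_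
    rw [hF p p' hp']
  rw [h1, h2, lintegral_const_mul, step_lintegral a b ha hb hb0 has hbs P hP j p hv]
  · rw [← Finset.mul_prod_erase _ _ hr, Finset.prod_eq_one]
    · simp only [h, stepLaw, if_true, mul_one, lintegral_const,
        Measure.restrict_apply MeasurableSet.univ, Set.univ_inter]
      exact le_of_eq (by ring)
    · intro v hv
      simp only [h, Finset.ne_of_mem_erase hv, if_false, mul_one]
      exact stepLaw_sum a b has hbs j _ v
  · exact Finset.measurable_prod _ fun w _ => (measurable_of_countable (h w)).comp (by fun_prop)

/-- supermartingale step -/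
lemma spine_super (ha : ∀ k ℓ, 0 ≤ a k ℓ) (hb : ∀ k ℓ, 0 ≤ b k ℓ) (hb0 : ∀ k, b k 0 = 0)
    (has : ∀ k, ∑' ℓ, ENNReal.ofReal (a k ℓ) = 1) (hbs : ∀ k, ∑' ℓ, ENNReal.ofReal (b k ℓ) = 1)
    (P : Measure Om) (hP : IsSpineLaw a b P)
    (n k : ℕ) (F : Om → ENNReal) (hF : ∀ p p', p' ∈ Atom (n + k) p → F p' = F p)
    (y z : ENNReal) (hy : y ≤ 1) (hz : ∑' ℓ, ENNReal.ofReal (a (n + k) ℓ) * y ^ ℓ ≤ z) :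
    ∫⁻ p, F p * y ^ ((Gen p.1 (rayVertex p.2 n) (k + 1)).card - 1) ∂P ≤
      ∫⁻ p, F p * z ^ ((Gen p.1 (rayVertex p.2 n) k).card - 1) ∂P := by
  have hval := ae_valid a b ha hb hb0 has hbs P hP
  refine decomp P (n + k) (Valid (n + k)) ((ae_all_iff.1 hval) (n + k)) _ _ ?_
  intro p hv
  set j := n + k with hj
  set r := rayVertex p.2 j with hrdef
  set D := Gen p.1 (rayVertex p.2 n) k with hD
  have hm := hv.mem n (by omega)
  have hrD : r ∈ D := Valid.mem_gen hv
  have hDS : D ⊆ Gen p.1 [] j := by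
    have := Gen_subset p.1 (rayVertex p.2 n) hm k
    rwa [rayVertex_length] at this
  have hr : r ∈ Gen p.1 [] j := hDS hrD
  let h : List ℕ → ℕ → ENNReal := fun v ℓ =>
    if v = r then y ^ (ℓ - 1) else if v ∈ D then y ^ ℓ else 1
  have h1 : ∫⁻ p' in Atom j p, F p' * y ^ ((Gen p'.1 (rayVertex p'.2 n) (k + 1)).card - 1) ∂P =
      ∫⁻ p' in Atom j p, F p * ∏ v ∈ Gen p.1 [] j, h v (p'.1 v) ∂P := by
    refine setLIntegral_congr_fun_ae (measurableSet_Atom j p) ?_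
    filter_upwards [hval] with p' hval' hp'
    rw [hF p p' hp', Atom.ray hp' n (by omega), card_Gen_succ, Atom.gen hp' _ hm k
      (by rw [rayVertex_length]), ← hD]
    congr 1
    have hpos : 1 ≤ p'.1 r := by
      have := hval' (j + 1) j (by omega)
      rw [Atom.ray hp' j le_rfl] at this
      exact Nat.one_le_of_lt this
    rw [← Finset.add_sum_erase _ _ hrD, ← Finset.prod_subset hDS, ← Finset.mul_prod_erase _ _ hrD]
    · have : ∏ x ∈ D.erase r, h x (p'.1 x) = ∏ x ∈ D.erase r, y ^ (p'.1 x) := by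
        refine Finset.prod_congr rfl fun v hv => ?_
        simp [h, Finset.ne_of_mem_erase hv, Finset.mem_of_mem_erase hv]
      rw [this, Finset.prod_pow_eq_pow_sum]
      simp only [h, if_true]
      rw [← pow_add]
      congr 1
      omega
    · intro v _ hvD
      have : v ≠ r := fun h => hvD (h ▸ hrD)
      simp [h, this, hvD]
  have h2 : ∫⁻ p' in Atom j p, F p' * z ^ ((Gen p'.1 (rayVertex p'.2 n) k).card - 1) ∂P =
      ∫⁻ p' in Atom j p, F p * z ^ (D.card - 1) ∂P := by
    refine setLIntegral_congr_fun (measurableSet_Atom j p) fun p' hp' => ?_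
    rw [hF p p' hp', Atom.ray hp' n (by omega), Atom.gen hp' _ hm k
      (by rw [rayVertex_length])]
  rw [h1, h2, lintegral_const_mul, step_lintegral a b ha hb hb0 has hbs P hP j p hv]
  · simp only [lintegral_const, Measure.restrict_apply MeasurableSet.univ, Set.univ_inter]
    rw [mul_assoc, mul_comm (z ^ _)]
    gcongr
    rw [← Finset.prod_subset hDS, ← Finset.mul_prod_erase _ _ hrD]
    · calc _ ≤ 1 * z ^ (D.card - 1) := by
            gcongr
            · rw [← stepLaw_sum a b has hbs j r r]
              refine ENNReal.tsum_le_tsum fun ℓ => ?_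
              simp only [h, if_true]
              exact mul_le_of_le_one_right' (pow_le_one₀ (by simp) hy)
            · rw [← Finset.card_erase_of_mem hrD]
              refine Finset.prod_le_pow_card _ _ _ fun v hv => ?_
              have hne : v ≠ r := Finset.ne_of_mem_erase hv
              simpa only [h, stepLaw, if_neg hne, if_neg (show v ≠ rayVertex p.2 j from hne), if_pos (Finset.mem_of_mem_erase hv)] using hz
        _ = _ := one_mul _
    · intro v _ hvD
      have : v ≠ r := fun h => hvD (h ▸ hrD)
      simp only [h, this, hvD, if_false, mul_one]
      exact stepLaw_sum a b has hbs j _ v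
  · exact Finset.measurable_prod _ fun w _ => (measurable_of_countable (h w)).comp (by fun_prop)

end spine

/-- GW measure pushed to marked trees -/
def gwM (GW : Measure Config) : Measure Om := GW.map (fun ω => (ω, fun _ => 0))

lemma gw_emb_meas : Measurable (fun ω : Config => ((ω, fun _ => 0) : Om)) := by fun_prop

lemma gw_ae (GW : Measure Config) : ∀ᵐ p ∂(gwM GW), ∀ k, p.2 k = 0 := by
  unfold gwM
  rw [ae_all_iff]
  intro k
  rw [ae_map_iff gw_emb_meas.aemeasurable]
  · exact ae_of_all _ fun _ => rfl
  · exact (measurableSet_singleton 0).preimage (f := fun p : Om => p.2 k) (by fun_prop)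

lemma gw_cyl (q : ℕ → ℝ) (GW : Measure Config) (hGW : IsGW q GW) (n : ℕ) (p : Om)
    (hp : ∀ k, p.2 k = 0) (S : Finset (List ℕ)) (hS : ∀ v ∈ S, v.length = n) (g : Config) :
    gwM GW (Atom n p ∩ {p' | ∀ v ∈ S, p'.1 v = g v}) =
      (∏ v ∈ (Finset.range n).biUnion (fun k => Gen p.1 [] k), ENNReal.ofReal (q (p.1 v))) *
        ∏ v ∈ S, ENNReal.ofReal (q (g v)) := by
  set T := (Finset.range n).biUnion (fun k => Gen p.1 [] k) with hT
  have hTm : ∀ v, v ∈ T ↔ v.length < n ∧ memTree p.1 v := by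
    intro v
    simp only [hT, Finset.mem_biUnion, Finset.mem_range, mem_Gen_nil]
    constructor
    · rintro ⟨k, hk, rfl, h⟩; exact ⟨hk, h⟩
    · rintro ⟨h, h'⟩; exact ⟨_, h, rfl, h'⟩
  have hdisj : Disjoint T S := by
    rw [Finset.disjoint_left]
    intro v h1 h2
    have := ((hTm v).1 h1).1
    have := hS v h2
    omega
  have hm : MeasurableSet (Atom n p ∩ {p' | ∀ v ∈ S, p'.1 v = g v}) := by
    refine (measurableSet_Atom n p).inter ?_
    have : {p' : Om | ∀ v ∈ S, p'.1 v = g v} = ⋂ v ∈ S, (fun p' : Om => p'.1 v) ⁻¹' {g v} := by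
      ext; simp
    rw [this]
    exact Finset.measurableSet_biInter _ fun v _ => (measurableSet_singleton _).preimage (by fun_prop)
  unfold gwM
  rw [Measure.map_apply gw_emb_meas hm]
  have := hGW.2 (T ∪ S) (fun v => if v.length < n then p.1 v else g v)
  rw [Finset.prod_union hdisj] at this
  have e1 : ∏ v ∈ T, ENNReal.ofReal (q (if v.length < n then p.1 v else g v)) =
      ∏ v ∈ T, ENNReal.ofReal (q (p.1 v)) :=
    Finset.prod_congr rfl fun v hv => by rw [if_pos ((hTm v).1 hv).1]
  have e2 : ∏ v ∈ S, ENNReal.ofReal (q (if v.length < n then p.1 v else g v)) =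
      ∏ v ∈ S, ENNReal.ofReal (q (g v)) :=
    Finset.prod_congr rfl fun v hv => by rw [if_neg (by rw [hS v hv]; omega)]
  rw [e1, e2] at this
  rw [← this]
  congr 1
  ext ω
  simp only [Set.mem_preimage, Set.mem_inter_iff, Atom, Set.mem_ofPred_eq, Finset.mem_union]
  constructor
  · rintro ⟨⟨h1, _⟩, h2⟩ v (hv | hv)
    · have := (hTm v).1 hv
      rw [if_pos this.1]; exact h1 v this.1 this.2
    · rw [if_neg (by rw [hS v hv]; omega)]; exact h2 v hv
  · intro h
    refine ⟨⟨fun v h1 h2 => ?_, fun k _ => (hp k).symm⟩, fun v hv => ?_⟩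
    · have := h v (Or.inl ((hTm v).2 ⟨h1, h2⟩))
      rwa [if_pos h1] at this
    · have := h v (Or.inr hv)
      rwa [if_neg (by rw [hS v hv]; omega)] at this

lemma gw_step (q : ℕ → ℝ) (GW : Measure Config) (hGW : IsGW q GW) (n : ℕ) (y : ENNReal) :
    ∫⁻ p, y ^ ((Gen p.1 [] (n + 1)).card) ∂(gwM GW) =
    ∫⁻ p, (∑' ℓ, ENNReal.ofReal (q ℓ) * y ^ ℓ) ^ ((Gen p.1 [] n).card) ∂(gwM GW) := by
  have key : ∀ p : Om, (∀ k, p.2 k = 0) →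
      ∫⁻ p' in Atom n p, y ^ ((Gen p'.1 [] (n + 1)).card) ∂(gwM GW) =
      ∫⁻ p' in Atom n p, (∑' ℓ, ENNReal.ofReal (q ℓ) * y ^ ℓ) ^ ((Gen p'.1 [] n).card) ∂(gwM GW) := by
    intro p hp
    have hS : ∀ v ∈ Gen p.1 [] n, v.length = n := fun v hv => ((mem_Gen_nil ..).1 hv).1
    have h1 : ∫⁻ p' in Atom n p, y ^ ((Gen p'.1 [] (n + 1)).card) ∂(gwM GW) =
        ∫⁻ p' in Atom n p, ∏ v ∈ Gen p.1 [] n, y ^ (p'.1 v) ∂(gwM GW) := by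
      refine setLIntegral_congr_fun (measurableSet_Atom n p) fun p' hp' => ?_
      rw [card_Gen_succ, Atom.gen hp' [] (memTree_nil _) n (by simp), Finset.prod_pow_eq_pow_sum]
    have h2 : ∫⁻ p' in Atom n p, (∑' ℓ, ENNReal.ofReal (q ℓ) * y ^ ℓ) ^ ((Gen p'.1 [] n).card) ∂(gwM GW)
        = ∫⁻ p' in Atom n p, (∑' ℓ, ENNReal.ofReal (q ℓ) * y ^ ℓ) ^ ((Gen p.1 [] n).card) ∂(gwM GW) := by
      refine setLIntegral_congr_fun (measurableSet_Atom n p) fun p' hp' => ?_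
      rw [Atom.gen hp' [] (memTree_nil _) n (by simp)]
    have hA : gwM GW (Atom n p) = ∏ v ∈ (Finset.range n).biUnion (fun k => Gen p.1 [] k),
        ENNReal.ofReal (q (p.1 v)) := by
      simpa using gw_cyl q GW hGW n p hp ∅ (by simp) 0
    rw [h1, h2, prod_lintegral (gwM GW) (Gen p.1 [] n) (fun _ ℓ => ENNReal.ofReal (q ℓ))
      (fun _ ℓ => y ^ ℓ) (Atom n p) (gwM GW (Atom n p)) (measurableSet_Atom n p)]
    · simp only [Finset.prod_const, lintegral_const,
        Measure.restrict_apply MeasurableSet.univ, Set.univ_inter]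
      rw [mul_comm]
    · intro g
      rw [hA]
      exact gw_cyl q GW hGW n p hp _ hS g
  exact le_antisymm (decomp _ n _ (gw_ae GW) _ _ fun p hp => (key p hp).le)
    (decomp _ n _ (gw_ae GW) _ _ fun p hp => (key p hp).ge)

/-- offspring generating function -/
def fq (q : ℕ → ℝ) (x : ℝ) : ℝ := ∑' ℓ, q ℓ * x ^ ℓ

lemma measurable_card_Gen (n : ℕ) : Measurable (fun p : Om => (Gen p.1 [] n).card) :=
  measurable_of_atom n _ fun p p' h => by rw [Atom.gen h [] (memTree_nil _) n (by simp)]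

lemma pgf_eq (GW : Measure Config) (n : ℕ) (x : ℝ) (hx : 0 ≤ x) :
    pgf GW n x = (∫⁻ p, (ENNReal.ofReal x) ^ ((Gen p.1 [] n).card) ∂(gwM GW)).toReal := by
  unfold pgf gwM
  have hmeas : Measurable (fun ω : Config => (Gen ω [] n).card) :=
    (measurable_card_Gen n).comp gw_emb_meas
  have hz : ∀ ω, Z ω [] n = (Gen ω [] n).card := fun ω => Z_eq_card ω [] (memTree_nil ω) n
  simp_rw [hz]
  have hm2 : Measurable (fun p : Om => (ENNReal.ofReal x) ^ ((Gen p.1 [] n).card)) :=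
    (measurable_of_countable (fun k : ℕ => (ENNReal.ofReal x) ^ k)).comp (measurable_card_Gen n)
  rw [lintegral_map hm2 gw_emb_meas, integral_eq_lintegral_of_nonneg_ae]
  · simp_rw [ENNReal.ofReal_pow hx]
  · exact ae_of_all _ fun ω => by positivity
  · exact ((measurable_of_countable (fun k : ℕ => x ^ k)).comp hmeas).aestronglyMeasurable

section fun_f
variable (q : ℕ → ℝ) (hq : ∀ ℓ, 0 ≤ q ℓ) (hq0 : q 0 = 0) (hs : Summable q) (hs1 : ∑' ℓ, q ℓ = 1)

include hq hs in
lemma fq_summable (x : ℝ) (hx0 : 0 ≤ x) (hx1 : x ≤ 1) : Summable (fun ℓ => q ℓ * x ^ ℓ) :=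
  Summable.of_nonneg_of_le (fun ℓ => mul_nonneg (hq ℓ) (by positivity))
    (fun ℓ => mul_le_of_le_one_right (hq ℓ) (pow_le_one₀ hx0 hx1)) hs

include hq hs in
lemma ofReal_fq (x : ℝ) (hx0 : 0 ≤ x) (hx1 : x ≤ 1) :
    ∑' ℓ, ENNReal.ofReal (q ℓ) * (ENNReal.ofReal x) ^ ℓ = ENNReal.ofReal (fq q x) := by
  unfold fq
  rw [ENNReal.ofReal_tsum_of_nonneg (fun ℓ => mul_nonneg (hq ℓ) (by positivity))
    (fq_summable q hq hs x hx0 hx1)]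
  refine tsum_congr fun ℓ => ?_
  rw [ENNReal.ofReal_mul (hq ℓ), ENNReal.ofReal_pow hx0]

include hq in
lemma fq_nonneg (x : ℝ) (hx0 : 0 ≤ x) : 0 ≤ fq q x :=
  tsum_nonneg fun ℓ => mul_nonneg (hq ℓ) (by positivity)

include hq hs in
lemma pgf_succ (GW : Measure Config) (hGW : IsGW q GW) (n : ℕ) (x : ℝ) (hx0 : 0 ≤ x) (hx1 : x ≤ 1) :
    pgf GW (n + 1) x = pgf GW n (fq q x) := by
  rw [pgf_eq GW _ x hx0, pgf_eq GW _ _ (fq_nonneg q hq x hx0), gw_step q GW hGW,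
    ofReal_fq q hq hs x hx0 hx1]

lemma pgf_zero (GW : Measure Config) [IsProbabilityMeasure GW] (x : ℝ) : pgf GW 0 x = x := by
  unfold pgf
  have hz : ∀ ω, Z ω [] 0 = 1 := fun ω => by rw [Z_eq_card ω [] (memTree_nil ω)]; simp [Gen]
  simp [hz]
end fun_f

set_option linter.unusedSectionVars false
/-- difference quotient at 1 -/
def gq (q : ℕ → ℝ) (x : ℝ) : ℝ := ∑' ℓ, q ℓ * ∑ i ∈ Finset.range ℓ, x ^ i

/-- derivative -/
def dq (q : ℕ → ℝ) (x : ℝ) : ℝ := ∑' ℓ : ℕ, q ℓ * ((ℓ : ℝ) * x ^ (ℓ - 1))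

section fun_f2
variable (q : ℕ → ℝ) (hq : ∀ ℓ, 0 ≤ q ℓ) (hq0 : q 0 = 0) (hs : Summable q) (hs1 : ∑' ℓ, q ℓ = 1)
  (hm : Summable (fun ℓ : ℕ => (ℓ : ℝ) * q ℓ))

lemma geomq_le (x : ℝ) (hx0 : 0 ≤ x) (hx1 : x ≤ 1) (ℓ : ℕ) : ∑ i ∈ Finset.range ℓ, x ^ i ≤ (ℓ : ℝ) := by
  calc _ ≤ ∑ i ∈ Finset.range ℓ, (1 : ℝ) := Finset.sum_le_sum fun i _ => pow_le_one₀ hx0 hx1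
    _ = ℓ := by simp

include hq hm in
lemma gq_summable (x : ℝ) (hx0 : 0 ≤ x) (hx1 : x ≤ 1) :
    Summable (fun ℓ => q ℓ * ∑ i ∈ Finset.range ℓ, x ^ i) :=
  Summable.of_nonneg_of_le (fun ℓ => mul_nonneg (hq ℓ) (Finset.sum_nonneg fun i _ => by positivity))
    (fun ℓ => by rw [mul_comm (ℓ : ℝ)]; exact mul_le_mul_of_nonneg_left (geomq_le x hx0 hx1 ℓ) (hq ℓ)) hm

include hq hs hs1 hm in
lemma one_sub_fq (x : ℝ) (hx0 : 0 ≤ x) (hx1 : x ≤ 1) : 1 - fq q x = (1 - x) * gq q x := by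
  unfold fq gq
  rw [← hs1, ← hs.tsum_sub (fq_summable q hq hs x hx0 hx1), hs1, ← tsum_mul_left]
  refine tsum_congr fun ℓ => ?_
  have := mul_neg_geom_sum x ℓ
  linear_combination (-q ℓ) * this

include hq hm in
lemma gq_mono (x y : ℝ) (hx0 : 0 ≤ x) (hxy : x ≤ y) (hy : y ≤ 1) : gq q x ≤ gq q y := by
  unfold gq
  refine (gq_summable q hq hm x hx0 (hxy.trans hy)).tsum_le_tsum (fun ℓ => ?_)
    (gq_summable q hq hm y (hx0.trans hxy) hy)
  exact mul_le_mul_of_nonneg_left (Finset.sum_le_sum fun i _ => by gcongr) (hq ℓ)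

include hq hq0 hs hs1 hm in
lemma gq_gt_one (hm1 : 1 < ∑' ℓ : ℕ, (ℓ : ℝ) * q ℓ) (x : ℝ) (hx0 : 0 < x) (hx1 : x ≤ 1) :
    1 < gq q x := by
  have hex : ∃ ℓ, 2 ≤ ℓ ∧ 0 < q ℓ := by
    by_contra! hcon
    have : ∑' ℓ : ℕ, (ℓ : ℝ) * q ℓ ≤ ∑' ℓ, q ℓ := by
      refine hm.tsum_le_tsum (fun ℓ => ?_) hs
      match ℓ with
      | 0 => simp [hq0]
      | 1 => simp
      | ℓ + 2 =>
        have := le_antisymm (hcon (ℓ + 2) (by omega)) (hq _)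
        simp [this]
    linarith
  obtain ⟨ℓ0, h2, hp⟩ := hex
  have hone : ∀ ℓ, 1 ≤ ℓ → 1 ≤ ∑ i ∈ Finset.range ℓ, x ^ i := by
    intro ℓ hℓ
    obtain ⟨k, rfl⟩ := Nat.exists_eq_add_of_le' hℓ
    rw [Finset.sum_range_succ']
    have : 0 ≤ ∑ i ∈ Finset.range k, x ^ (i + 1) := Finset.sum_nonneg fun i _ => by positivity
    simp; linarith
  rw [← hs1]
  unfold gq
  refine Summable.tsum_lt_tsum (i := ℓ0) (fun ℓ => ?_) ?_ hs (gq_summable q hq hm x hx0.le hx1)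
  · match ℓ with
    | 0 => simp [hq0]
    | ℓ + 1 => exact le_mul_of_one_le_right (hq _) (hone _ (by omega))
  · obtain ⟨k, rfl⟩ := Nat.exists_eq_add_of_le' h2
    refine lt_mul_of_one_lt_right hp ?_
    rw [Finset.sum_range_succ]
    have := hone (k + 1) (by omega)
    have : 0 < x ^ (k + 1) := by positivity
    linarith

include hq hm in
lemma gq_tendsto (x : ℕ → ℝ) (hx : ∀ n, x n ∈ Set.Ioo (0 : ℝ) 1) (hlim : Tendsto x atTop (nhds 1)) :
    Tendsto (fun n => gq q (x n)) atTop (nhds (∑' ℓ : ℕ, (ℓ : ℝ) * q ℓ)) := by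
  unfold gq
  refine tendsto_tsum_of_dominated_convergence (bound := fun ℓ : ℕ => (ℓ : ℝ) * q ℓ) hm ?_ ?_
  · intro ℓ
    have : (ℓ : ℝ) * q ℓ = q ℓ * ∑ i ∈ Finset.range ℓ, (1 : ℝ) ^ i := by simp [mul_comm]
    rw [this]
    exact (tendsto_finsetSum _ fun i _ => hlim.pow i).const_mul _
  · refine Eventually.of_forall fun n ℓ => ?_
    rw [Real.norm_of_nonneg (mul_nonneg (hq ℓ) (Finset.sum_nonneg fun i _ => pow_nonneg (hx n).1.le _)),
      mul_comm (ℓ : ℝ)]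
    exact mul_le_mul_of_nonneg_left (geomq_le (x n) (hx n).1.le (hx n).2.le ℓ) (hq ℓ)

include hq hq0 hs hs1 in
lemma fq_pos (x : ℝ) (hx0 : 0 < x) (hx1 : x ≤ 1) : 0 < fq q x := by
  have hex : ∃ ℓ, 0 < q ℓ := by
    by_contra! hcon
    have : ∀ ℓ, q ℓ = 0 := fun ℓ => le_antisymm (hcon ℓ) (hq ℓ)
    simp [this] at hs1
  obtain ⟨ℓ, h⟩ := hex
  exact (fq_summable q hq hs x hx0.le hx1).tsum_pos (fun i => mul_nonneg (hq i) (by positivity)) ℓ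
    (by positivity)

include hq hq0 hs hs1 hm in
lemma fq_le (hm1 : 1 < ∑' ℓ : ℕ, (ℓ : ℝ) * q ℓ) (x : ℝ) (hx0 : 0 < x) (hx1 : x ≤ 1) :
    fq q x ≤ x := by
  have h1 := one_sub_fq q hq hs hs1 hm x hx0.le hx1
  have h2 := gq_gt_one q hq hq0 hs hs1 hm hm1 x hx0 hx1
  nlinarith

include hq hq0 hs hs1 hm in
lemma fq_Ioo (hm1 : 1 < ∑' ℓ : ℕ, (ℓ : ℝ) * q ℓ) (x : ℝ) (hx : x ∈ Set.Ioo (0 : ℝ) 1) :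
    fq q x ∈ Set.Ioo (0 : ℝ) 1 :=
  ⟨fq_pos q hq hq0 hs hs1 x hx.1 hx.2.le,
    (fq_le q hq hq0 hs hs1 hm hm1 x hx.1 hx.2.le).trans_lt hx.2⟩

include hq hm in
lemma dq_summable (x : ℝ) (hx0 : 0 ≤ x) (hx1 : x ≤ 1) :
    Summable (fun ℓ : ℕ => q ℓ * ((ℓ : ℝ) * x ^ (ℓ - 1))) := by
  refine Summable.of_nonneg_of_le (fun ℓ => mul_nonneg (hq ℓ) (by positivity)) (fun ℓ => ?_) hm
  rw [mul_comm (ℓ : ℝ) (q ℓ)]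
  exact mul_le_mul_of_nonneg_left (mul_le_of_le_one_right (by positivity) (pow_le_one₀ hx0 hx1)) (hq ℓ)

include hq hm in
lemma dq_le (x : ℝ) (hx0 : 0 ≤ x) (hx1 : x ≤ 1) : dq q x ≤ ∑' ℓ : ℕ, (ℓ : ℝ) * q ℓ := by
  refine (dq_summable q hq hm x hx0 hx1).tsum_le_tsum (fun ℓ => ?_) hm
  rw [mul_comm (ℓ : ℝ) (q ℓ)]
  exact mul_le_mul_of_nonneg_left (mul_le_of_le_one_right (by positivity) (pow_le_one₀ hx0 hx1)) (hq ℓ)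

include hq hq0 hs hs1 hm in
lemma dq_pos (x : ℝ) (hx0 : 0 < x) (hx1 : x ≤ 1) : 0 < dq q x := by
  have hex : ∃ ℓ, 0 < q ℓ := by
    by_contra! hcon
    have : ∀ ℓ, q ℓ = 0 := fun ℓ => le_antisymm (hcon ℓ) (hq ℓ)
    simp [this] at hs1
  obtain ⟨ℓ, h⟩ := hex
  have hℓ : 0 < ℓ := Nat.pos_of_ne_zero fun h0 => by rw [h0, hq0] at h; exact lt_irrefl _ h
  exact (dq_summable q hq hm x hx0.le hx1).tsum_pos (fun i => mul_nonneg (hq i) (by positivity)) ℓ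
    (by positivity)

include hq hs hm in
lemma fq_hasDerivAt (x : ℝ) (hx : x ∈ Set.Ioo (0 : ℝ) 1) : HasDerivAt (fq q) (dq q x) x := by
  have := hasDerivAt_tsum_of_isPreconnected (u := fun ℓ : ℕ => (ℓ : ℝ) * q ℓ)
    (g := fun ℓ x => q ℓ * x ^ ℓ) (g' := fun ℓ x => q ℓ * ((ℓ : ℝ) * x ^ (ℓ - 1))) (t := Set.Ioo (0 : ℝ) 1)
    (y₀ := x) (y := x) hm isOpen_Ioo isPreconnected_Ioo
    (fun ℓ y _ => (hasDerivAt_pow ℓ y).const_mul (q ℓ)) ?_ hx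
    (fq_summable q hq hs x hx.1.le hx.2.le) hx
  · exact this
  · intro ℓ y hy
    rw [Real.norm_of_nonneg (mul_nonneg (hq ℓ) (mul_nonneg (by positivity) (pow_nonneg hy.1.le _))),
      mul_comm (ℓ : ℝ) (q ℓ)]
    exact mul_le_mul_of_nonneg_left
      (mul_le_of_le_one_right (by positivity) (pow_le_one₀ hy.1.le hy.2.le)) (hq ℓ)

include hq hq0 hs hs1 hm in
lemma pgf_diff (hm1 : 1 < ∑' ℓ : ℕ, (ℓ : ℝ) * q ℓ) (GW : Measure Config) (hGW : IsGW q GW) (n : ℕ) :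
    ∀ x ∈ Set.Ioo (0 : ℝ) 1, DifferentiableAt ℝ (pgf GW n) x ∧ 0 < deriv (pgf GW n) x ∧
      deriv (pgf GW (n + 1)) x = deriv (pgf GW n) (fq q x) * dq q x := by
  have := hGW.1
  have key : ∀ n x, x ∈ Set.Ioo (0 : ℝ) 1 → DifferentiableAt ℝ (pgf GW n) (fq q x) →
      HasDerivAt (pgf GW (n + 1)) (deriv (pgf GW n) (fq q x) * dq q x) x := by
    intro n x hx hd
    have h1 := hd.hasDerivAt.comp x (fq_hasDerivAt q hq hs hm x hx)
    refine h1.congr_of_eventuallyEq ?_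
    filter_upwards [isOpen_Ioo.mem_nhds hx] with y hy
    exact pgf_succ q hq hs GW hGW n y hy.1.le hy.2.le
  have h2 : ∀ n, ∀ x ∈ Set.Ioo (0 : ℝ) 1, DifferentiableAt ℝ (pgf GW n) x ∧ 0 < deriv (pgf GW n) x := by
    intro n
    induction n with
    | zero =>
      intro x _
      have : pgf GW 0 = id := by ext x; simp [pgf_zero]
      simp [this]
    | succ n ih =>
      intro x hx
      have hf := fq_Ioo q hq hq0 hs hs1 hm hm1 x hx
      have := key n x hx (ih _ hf).1
      refine ⟨this.differentiableAt, ?_⟩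
      rw [this.deriv]
      exact mul_pos (ih _ hf).2 (dq_pos q hq hq0 hs hs1 hm x hx.1 hx.2.le)
  intro x hx
  refine ⟨(h2 n x hx).1, (h2 n x hx).2, ?_⟩
  exact (key n x hx (h2 n _ (fq_Ioo q hq hq0 hs hs1 hm hm1 x hx)).1).deriv

include hq hq0 hs hs1 hm in
lemma x_tendsto (hm1 : 1 < ∑' ℓ : ℕ, (ℓ : ℝ) * q ℓ) (x : ℕ → ℝ) (hx : ∀ n, x n ∈ Set.Ioo (0 : ℝ) 1)
    (hrec : ∀ n, fq q (x (n + 1)) = x n) : Tendsto x atTop (nhds 1) := by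
  have hmono : Monotone x := monotone_nat_of_le_succ fun n => by
    rw [← hrec n]; exact fq_le q hq hq0 hs hs1 hm hm1 _ (hx _).1 (hx _).2.le
  set G := gq q (x 0)
  have hG : 1 < G := gq_gt_one q hq hq0 hs hs1 hm hm1 _ (hx 0).1 (hx 0).2.le
  have hb : ∀ n, 1 - x n ≤ (1 - x 0) * (G⁻¹) ^ n := by
    intro n
    induction n with
    | zero => simp
    | succ n ih =>
      have h1 := one_sub_fq q hq hs hs1 hm (x (n + 1)) (hx _).1.le (hx _).2.le
      rw [hrec] at h1
      have h2 : G ≤ gq q (x (n + 1)) := gq_mono q hq hm _ _ (hx 0).1.le (hmono (by omega)) (hx _).2.le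
      have h3 : (1 - x (n + 1)) * G ≤ (1 - x 0) * (G⁻¹) ^ n := by
        have := (hx (n + 1)).2
        nlinarith
      rw [pow_succ, ← mul_assoc, ← div_eq_mul_inv, le_div_iff₀ (by linarith)]
      exact h3
  have h0 : Tendsto (fun n => (1 - x 0) * (G⁻¹) ^ n) atTop (nhds 0) := by
    have := (tendsto_pow_atTop_nhds_zero_of_lt_one (r := G⁻¹) (by positivity)
      (inv_lt_one_of_one_lt₀ hG)).const_mul (1 - x 0)
    simpa using this
  have h1 : Tendsto (fun n => 1 - x n) atTop (nhds 0) :=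
    squeeze_zero (fun n => by linarith [(hx n).2]) hb h0
  simpa using (tendsto_const_nhds (x := (1 : ℝ))).sub h1

include hq hq0 hs hs1 hm in
lemma log_ratio (hm1 : 1 < ∑' ℓ : ℕ, (ℓ : ℝ) * q ℓ) (x : ℕ → ℝ) (hx : ∀ n, x n ∈ Set.Ioo (0 : ℝ) 1)
    (hrec : ∀ n, fq q (x (n + 1)) = x n) :
    Tendsto (fun n => Real.log (x n) / Real.log (x (n + 1))) atTop (nhds (∑' ℓ : ℕ, (ℓ : ℝ) * q ℓ)) := by
  have hlim := x_tendsto q hq hq0 hs hs1 hm hm1 x hx hrec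
  have hlim1 : Tendsto (fun n => x (n + 1)) atTop (nhds 1) := hlim.comp (tendsto_add_atTop_nat 1)
  have hl : Tendsto (fun n => Real.log (x n) / (x n - 1)) atTop (nhds 1) := by
    have h := (hasDerivAt_iff_tendsto_slope.1 (Real.hasDerivAt_log one_ne_zero))
    have h2 : Tendsto x atTop (nhdsWithin 1 {1}ᶜ) :=
      tendsto_nhdsWithin_iff.2 ⟨hlim, Eventually.of_forall fun n => (hx n).2.ne⟩
    have := h.comp h2
    simpa [slope_def_field, Function.comp_def] using this
  have hl1 := hl.comp (tendsto_add_atTop_nat 1)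
  have hg := gq_tendsto q hq hm (fun n => x (n + 1)) (fun n => hx _) hlim1
  have := (hl.mul hg).div hl1 one_ne_zero
  simp only [one_mul, div_one] at this
  refine this.congr fun n => ?_
  have h1 := one_sub_fq q hq hs hs1 hm (x (n + 1)) (hx _).1.le (hx _).2.le
  rw [hrec] at h1
  have e1 : x n - 1 ≠ 0 := by linarith [(hx n).2]
  have e2 : x (n + 1) - 1 ≠ 0 := by linarith [(hx (n + 1)).2]
  have e3 : Real.log (x (n + 1)) ≠ 0 := (Real.log_neg (hx _).1 (hx _).2).ne
  simp only [Pi.div_apply, Function.comp_def]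
  have h3 : gq q (x (n + 1)) = (x n - 1) / (x (n + 1) - 1) := by
    rw [eq_div_iff e2]; linarith
  rw [h3]
  field_simp
end fun_f2

set_option linter.unusedSectionVars false

/-! growth of c -/
section cgrowth
variable (m : ℝ) (hm1 : 1 < m) (c : ℕ → ℝ) (hc : ∀ n, 0 < c n)
  (hr : Tendsto (fun n => c (n + 1) / c n) atTop (nhds m))

include hm1 hc hr in
lemma logc_tendsto : Tendsto (fun n : ℕ => Real.log (c n) / n) atTop (nhds (Real.log m)) := by
  have h1 : Tendsto (fun n => Real.log (c (n + 1) / c n)) atTop (nhds (Real.log m)) :=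
    hr.log (by linarith)
  have h2 := h1.cesaro
  have h3 : Tendsto (fun n : ℕ => Real.log (c 0) / n) atTop (nhds 0) :=
    tendsto_const_div_atTop_nhds_zero_nat _
  have h4 := h2.add h3
  rw [add_zero] at h4
  refine h4.congr fun n => ?_
  have : ∑ i ∈ Finset.range n, Real.log (c (i + 1) / c i) = Real.log (c n) - Real.log (c 0) := by
    rw [← Finset.sum_range_sub (fun i => Real.log (c i))]
    exact Finset.sum_congr rfl fun i _ => Real.log_div (hc _).ne' (hc _).ne'
  rw [this]
  ring

include hm1 hc hr in
lemma c_lower (β : ℝ) (hβ : β < Real.log m) : ∀ᶠ n : ℕ in atTop, Real.exp (β * n) ≤ c n := by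
  filter_upwards [(logc_tendsto m hm1 c hc hr).eventually_const_lt hβ, eventually_gt_atTop 0] with n h hn
  have hn' : (0 : ℝ) < n := by exact_mod_cast hn
  rw [lt_div_iff₀ hn'] at h
  rw [← Real.exp_log (hc n)]
  exact Real.exp_le_exp.2 h.le

include hm1 hc hr in
lemma c_upper (β : ℝ) (hβ : Real.log m < β) : ∀ᶠ n : ℕ in atTop, c n ≤ Real.exp (β * n) := by
  filter_upwards [(logc_tendsto m hm1 c hc hr).eventually_lt_const hβ, eventually_gt_atTop 0] with n h hn
  have hn' : (0 : ℝ) < n := by exact_mod_cast hn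
  rw [div_lt_iff₀ hn'] at h
  rw [← Real.exp_log (hc n)]
  exact Real.exp_le_exp.2 h.le

include hm1 hc hr in
lemma c_tendsto : Tendsto c atTop atTop := by
  have hl : 0 < Real.log m := Real.log_pos hm1
  refine tendsto_atTop_mono' _ (c_lower m hm1 c hc hr (Real.log m / 2) (by linarith)) ?_
  exact Real.tendsto_exp_atTop.comp
    (tendsto_natCast_atTop_atTop.const_mul_atTop (by linarith))

include hm1 hc hr in
lemma c_shift (d : ℕ) : Tendsto (fun k => c k / c (k + d)) atTop (nhds ((m ^ d)⁻¹)) := by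
  induction d with
  | zero =>
    have : (fun k => c k / c (k + 0)) = fun _ => (1 : ℝ) := by
      ext k; simp [(hc k).ne']
    rw [this]; simp
  | succ d ih =>
    have h1 := (hr.comp (tendsto_add_atTop_nat d)).inv₀ (by linarith : m ≠ 0)
    have h2 := ih.mul h1
    rw [← mul_inv, ← pow_succ] at h2
    refine h2.congr fun k => ?_
    have := (hc (k + d)).ne'
    have := (hc (k + (d + 1))).ne'
    have h3 : k + d + 1 = k + (d + 1) := by ring
    simp only [Function.comp_def, h3]
    field_simp

/-- summability of the error bound -/
lemma exp_bound (γ : ℝ) (hγ0 : 0 < γ) (hγ1 : γ < 1) (hm1 : 1 < m) (hc : ∀ n, 0 < c n)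
    (hr : Tendsto (fun n => c (n + 1) / c n) atTop (nhds m)) (β : ℝ) (hβ1 : γ * Real.log m < β)
    (hβ2 : β < Real.log m) :
    ∀ᶠ n : ℕ in atTop, (n : ℝ) ≤ (Real.exp (β * n) - 1) * (1 / c ⌊γ * n⌋₊ - 1 / c (n + 1)) := by
  have hl : 0 < Real.log m := Real.log_pos hm1
  have hβ0 : 0 < β := lt_trans (by positivity) hβ1
  set β' := (γ * Real.log m + β) / 2 with hβ'
  set κ := β' / γ with hκ
  have hκm : Real.log m < κ := by
    rw [hκ, lt_div_iff₀ hγ0]; linarith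
  have hfl : Tendsto (fun n : ℕ => ⌊γ * n⌋₊) atTop atTop :=
    tendsto_nat_floor_atTop.comp (tendsto_natCast_atTop_atTop.const_mul_atTop hγ0)
  have e1 := hfl.eventually (c_upper m hm1 c hc hr κ hκm)
  have e2 := (tendsto_add_atTop_nat 1).eventually (c_lower m hm1 c hc hr β hβ2)
  have hδ : 0 < β - β' := by linarith
  have e3 : ∀ᶠ n : ℕ in atTop, (n : ℝ) + 2 ≤ Real.exp ((β - β') * n) := by
    have h := (isLittleO_pow_exp_pos_mul_atTop 1 hδ).comp_tendsto tendsto_natCast_atTop_atTop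
    have h' := h.bound (c := 1 / 3) (by norm_num)
    filter_upwards [h', eventually_ge_atTop 1] with n hn h1
    have h1' : (1 : ℝ) ≤ n := by exact_mod_cast h1
    simp only [Function.comp_def, pow_one, Real.norm_eq_abs, Nat.abs_cast, Real.abs_exp] at hn
    linarith
  filter_upwards [e1, e2, e3] with n h1 h2 h3
  have hn0 : (0 : ℝ) ≤ n := Nat.cast_nonneg n
  have f1 : c ⌊γ * n⌋₊ ≤ Real.exp (β' * n) := by
    refine h1.trans (Real.exp_le_exp.2 ?_)
    have : (⌊γ * (n : ℝ)⌋₊ : ℝ) ≤ γ * n := Nat.floor_le (by positivity)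
    have hκ0 : 0 < κ := hl.trans hκm
    calc κ * (⌊γ * (n : ℝ)⌋₊ : ℝ) ≤ κ * (γ * n) := by gcongr
      _ = β' * n := by rw [hκ]; field_simp
  have f2 : Real.exp (β * n) ≤ c (n + 1) := by
    refine le_trans (Real.exp_le_exp.2 ?_) h2
    push_cast; nlinarith
  have g1 : Real.exp (-(β' * n)) ≤ 1 / c ⌊γ * n⌋₊ := by
    rw [Real.exp_neg, ← one_div]; exact one_div_le_one_div_of_le (hc _) f1
  have g2 : 1 / c (n + 1) ≤ Real.exp (-(β * n)) := by
    rw [Real.exp_neg, ← one_div]; exact one_div_le_one_div_of_le (Real.exp_pos _) f2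
  have g3 : (1 : ℝ) ≤ Real.exp (β * n) := Real.one_le_exp (by positivity)
  have g4 : Real.exp (-(β' * n)) ≤ 1 := Real.exp_le_one_iff.2 (by
    have : 0 < β' := by rw [hβ']; positivity
    have : 0 ≤ β' * n := by positivity
    linarith)
  have g5 : Real.exp (β * n) * Real.exp (-(β' * n)) = Real.exp ((β - β') * n) := by
    rw [← Real.exp_add]; ring_nf
  have g6 : Real.exp (β * n) * Real.exp (-(β * n)) = 1 := by
    rw [← Real.exp_add]; simp
  have g7 := Real.exp_pos (-(β * n))
  calc (n : ℝ) ≤ (Real.exp (β * n) - 1) * (Real.exp (-(β' * n)) - Real.exp (-(β * n))) := by nlinarith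
    _ ≤ _ := by
      refine mul_le_mul_of_nonneg_left ?_ (by linarith)
      linarith
end cgrowth

lemma final_det (u : ℕ → ℝ) (L C : ℝ) (hL : 0 < L) (hup : ∀ n : ℕ, 1 ≤ n → u n ≤ C / n + L)
    (hlow : ∀ k : ℕ, ∃ᶠ n : ℕ in atTop, (1 - 1 / ((k : ℝ) + 2)) * L - 2 * L / n ≤ u n) :
    limsup u atTop = L := by
  have hfreq : ∀ a < L, ∃ᶠ n in atTop, a ≤ u n := by
    intro a ha
    have h1 : Tendsto (fun k : ℕ => (1 - 1 / ((k : ℝ) + 2)) * L) atTop (nhds ((1 - 0) * L)) := by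
      refine (tendsto_const_nhds.sub ?_).mul_const L
      exact tendsto_const_nhds.div_atTop
        (tendsto_atTop_add_const_right _ _ tendsto_natCast_atTop_atTop)
    simp only [sub_zero, one_mul] at h1
    obtain ⟨k, hk⟩ := (h1.eventually_const_lt ha).exists
    have h2 : Tendsto (fun n : ℕ => (1 - 1 / ((k : ℝ) + 2)) * L - 2 * L / n) atTop
        (nhds ((1 - 1 / ((k : ℝ) + 2)) * L - 0)) :=
      tendsto_const_nhds.sub (tendsto_const_div_atTop_nhds_zero_nat _)
    rw [sub_zero] at h2
    refine ((hlow k).and_eventually (h2.eventually_const_lt hk)).mono ?_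
    rintro n ⟨h3, h4⟩
    linarith
  have hlim : Tendsto (fun n : ℕ => C / n + L) atTop (nhds L) := by
    have := (tendsto_const_div_atTop_nhds_zero_nat C).add_const L
    simpa using this
  have hev : u ≤ᶠ[atTop] fun n : ℕ => C / n + L := by
    filter_upwards [eventually_ge_atTop 1] with n hn using hup n hn
  have hbdd : IsBoundedUnder (· ≤ ·) atTop u := hlim.isBoundedUnder_le.mono_le hev
  have hcob : IsCoboundedUnder (· ≤ ·) atTop u :=
    IsCoboundedUnder.of_frequently_ge (hfreq (L - 1) (by linarith))
  refine le_antisymm ?_ ?_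
  · have := limsup_le_limsup hev hcob hlim.isBoundedUnder_le
    rwa [hlim.limsup_eq] at this
  · exact le_of_forall_lt fun a ha => by
      obtain ⟨a', h1, h2⟩ := exists_between ha
      exact h1.trans_le (le_limsup_of_frequently_le (hfreq a' h2) hbdd)

set_option linter.unusedSectionVars false

/-- the spine vertex has many children -/
def Bn (β : ℝ) (n : ℕ) : Set Om :=
  {p | memTree p.1 (rayVertex p.2 n) ∧ Real.exp (β * n) ≤ (p.1 (rayVertex p.2 n) : ℝ)}

lemma Bn_det (β : ℝ) (n j : ℕ) (hj : n < j) (p p' : Om) (h : p' ∈ Atom j p) :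
    p' ∈ Bn β n ↔ p ∈ Bn β n := by
  unfold Bn
  simp only [Set.mem_ofPred_eq]
  rw [Atom.ray h n hj.le, Atom.mtree h _ (by rw [rayVertex_length]; exact hj.le)]
  refine and_congr_right fun hm => ?_
  rw [h.1 _ (by rw [rayVertex_length]; exact hj) hm]


lemma Bn_step (a b : ℕ → ℕ → ℝ) (ha : ∀ k ℓ, 0 ≤ a k ℓ) (hb : ∀ k ℓ, 0 ≤ b k ℓ) (hb0 : ∀ k, b k 0 = 0)
    (has : ∀ k, ∑' ℓ, ENNReal.ofReal (a k ℓ) = 1) (hbs : ∀ k, ∑' ℓ, ENNReal.ofReal (b k ℓ) = 1)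
    (P : Measure Om) (hP : IsSpineLaw a b P) (β : ℝ) (N k : ℕ) (E : Set Om)
    (hEdef : E = {p : Om | ∀ n, N ≤ n → n < N + k → p ∉ Bn β n})
    (hEdet : ∀ p p', p' ∈ Atom (N + k) p → (p' ∈ E ↔ p ∈ E)) (y : ENNReal)
    (hy : ∑' ℓ : ℕ, ENNReal.ofReal (b (N + k) ℓ) * (if Real.exp (β * (N + k : ℕ)) ≤ (ℓ : ℝ) then 0 else 1) ≤ y)
    (z : ENNReal) (hz : P E ≤ z) :
    P {p | ∀ n, N ≤ n → n < N + (k + 1) → p ∉ Bn β n} ≤ z * y := by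
  classical
  have hval := ae_valid a b ha hb hb0 has hbs P hP
  have hEm : MeasurableSet E := by
    have := measurable_of_atom (N + k) (fun p => p ∈ E)
      (fun p p' h => propext (hEdet p p' h))
    exact measurableSet_setOfPred.2 this
  let F : Om → ENNReal := E.indicator 1
  let H : ℕ → ENNReal := fun ℓ => if Real.exp (β * (N + k : ℕ)) ≤ (ℓ : ℝ) then 0 else 1
  have hFd : ∀ p p', p' ∈ Atom (N + k) p → F p' = F p := by
    intro p p' h
    simp only [F, Set.indicator_apply, hEdet p p' h, Pi.one_apply]
  have hL := spine_L a b ha hb hb0 has hbs P hP (N + k) F hFd H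
  have h1 : P {p | ∀ n, N ≤ n → n < N + (k + 1) → p ∉ Bn β n} ≤
      ∫⁻ p, F p * H (p.1 (rayVertex p.2 (N + k))) ∂P := by
    have hset : MeasurableSet (E ∩ {p : Om | ¬ Real.exp (β * (N + k : ℕ)) ≤
        (p.1 (rayVertex p.2 (N + k)) : ℝ)}) := by
      refine hEm.inter ?_
      exact (measurableSet_le measurable_const
        ((measurable_of_countable (fun k : ℕ => (k : ℝ))).comp (measurable_L (N + k)))).compl
    have : ∫⁻ p, F p * H (p.1 (rayVertex p.2 (N + k))) ∂P =
        P (E ∩ {p : Om | ¬ Real.exp (β * (N + k : ℕ)) ≤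
        (p.1 (rayVertex p.2 (N + k)) : ℝ)}) := by
      rw [← lintegral_indicator_one hset]
      refine lintegral_congr fun p => ?_
      simp only [F, H, Set.indicator_apply, Set.mem_inter_iff, Set.mem_ofPred_eq, Pi.one_apply]
      clear hset hL hFd hEm hEdet hEdef hval hy hz
      by_cases h1 : p ∈ E
      · by_cases h2 : Real.exp (β * (N + k : ℕ)) ≤ (p.1 (rayVertex p.2 (N + k)) : ℝ)
        · rw [if_pos h1, if_pos h2, if_neg (fun h => h.2 h2), mul_zero]
        · rw [if_pos h1, if_neg h2, if_pos ⟨h1, h2⟩, mul_one]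
      · rw [if_neg h1, zero_mul, if_neg (fun h => h1 h.1)]
    rw [this]
    refine measure_mono_ae ?_
    filter_upwards [hval] with p hv hp
    refine ⟨?_, fun h => ?_⟩
    · rw [hEdef]; exact fun n h1 h2 => hp n h1 (by omega)
    · exact hp (N + k) (by omega) (by omega) ⟨(hv (N + k)).mem _ le_rfl, h⟩
  refine h1.trans (hL.trans ?_)
  rw [lintegral_mul_const _ (measurable_of_atom (N + k) F hFd), lintegral_indicator_one hEm]
  exact mul_le_mul' hz hy

section main
variable (q : ℕ → ℝ) (hq : ∀ ℓ, 0 ≤ q ℓ) (hq0 : q 0 = 0) (hs : Summable q) (hs1 : ∑' ℓ, q ℓ = 1)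
  (hm : Summable (fun ℓ : ℕ => (ℓ : ℝ) * q ℓ)) (m : ℝ) (hmd : m = ∑' ℓ : ℕ, (ℓ : ℝ) * q ℓ) (hm1 : 1 < m)
  (x c : ℕ → ℝ) (hx : ∀ n, x n ∈ Set.Ioo (0 : ℝ) 1) (hrec : ∀ n, fq q (x (n + 1)) = x n)
  (hc : ∀ n, 0 < c n) (hxc : ∀ n, x n = Real.exp (-(1 / c n)))
  (hr : Tendsto (fun n => c (n + 1) / c n) atTop (nhds m))
  (a b : ℕ → ℕ → ℝ) (hae : ∀ k ℓ, a k ℓ = q ℓ * x (k + 1) ^ ℓ / x k)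
  (hbe : ∀ k ℓ, b k ℓ = q ℓ * ((ℓ : ℝ) * x (k + 1) ^ (ℓ - 1)) / dq q (x (k + 1)))
  (P : Measure Om) (hP : IsSpineLaw a b P)

include hq hx hae in
lemma a_nonneg (k ℓ : ℕ) : 0 ≤ a k ℓ := by
  rw [hae]
  exact div_nonneg (mul_nonneg (hq _) (pow_nonneg (hx _).1.le _)) (hx _).1.le

include hq hq0 hs hs1 hm hx hbe in
lemma b_nonneg (k ℓ : ℕ) : 0 ≤ b k ℓ := by
  rw [hbe]
  exact div_nonneg (mul_nonneg (hq _) (mul_nonneg (Nat.cast_nonneg _) (pow_nonneg (hx _).1.le _)))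
    (dq_pos q hq hq0 hs hs1 hm _ (hx _).1 (hx _).2.le).le

include hq0 hbe in
lemma b_zero (k : ℕ) : b k 0 = 0 := by
  rw [hbe]; simp

include hq hs hx hrec hae in
lemma a_gen (k : ℕ) (y : ℝ) (hy0 : 0 ≤ y) (hy1 : y * x (k + 1) ≤ 1) :
    ∑' ℓ, ENNReal.ofReal (a k ℓ) * ENNReal.ofReal y ^ ℓ = ENNReal.ofReal (fq q (y * x (k + 1)) / x k) := by
  have h0 : 0 ≤ y * x (k + 1) := mul_nonneg hy0 (hx _).1.le
  unfold fq
  rw [← tsum_div_const, ENNReal.ofReal_tsum_of_nonneg]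
  · refine tsum_congr fun ℓ => ?_
    rw [← ENNReal.ofReal_pow hy0, ← ENNReal.ofReal_mul (a_nonneg q hq x hx a hae k ℓ), hae]
    congr 1
    rw [mul_pow]; ring
  · intro ℓ
    exact div_nonneg (mul_nonneg (hq _) (pow_nonneg h0 _)) (hx _).1.le
  · exact (fq_summable q hq hs _ h0 hy1).div_const _

include hq hs hx hrec hae in
lemma a_sum (k : ℕ) : ∑' ℓ, ENNReal.ofReal (a k ℓ) = 1 := by
  have := a_gen q hq hs x hx hrec a hae k 1 zero_le_one (by rw [one_mul]; exact (hx _).2.le)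
  simp only [ENNReal.ofReal_one, one_pow, mul_one, one_mul] at this
  rw [this, hrec, div_self (hx _).1.ne', ENNReal.ofReal_one]

include hq hq0 hs hs1 hm hx hbe in
lemma b_sum (k : ℕ) : ∑' ℓ, ENNReal.ofReal (b k ℓ) = 1 := by
  have hd := dq_pos q hq hq0 hs hs1 hm _ (hx (k + 1)).1 (hx (k + 1)).2.le
  rw [← ENNReal.ofReal_tsum_of_nonneg (b_nonneg q hq hq0 hs hs1 hm x hx b hbe k)]
  · simp_rw [hbe]
    rw [tsum_div_const]
    change ENNReal.ofReal (dq q _ / dq q _) = 1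
    rw [div_self hd.ne', ENNReal.ofReal_one]
  · have e : b k = fun ℓ => q ℓ * ((ℓ : ℝ) * x (k + 1) ^ (ℓ - 1)) / dq q (x (k + 1)) := funext (hbe k)
    rw [e]
    exact (dq_summable q hq hm _ (hx (k + 1)).1.le (hx (k + 1)).2.le).div_const _

include hq hq0 hs hs1 hm hx hrec hae hbe hP in
lemma super_all (n i : ℕ) (hin : i ≤ n + 1) (hmono : Monotone x) (F : Om → ENNReal)
    (hF : ∀ p p', p' ∈ Atom (n + 1) p → F p' = F p) (k : ℕ) :
    ∫⁻ p, F p * ENNReal.ofReal (x (i + k) / x (n + 1 + k)) ^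
        ((Gen p.1 (rayVertex p.2 n) (k + 1)).card - 1) ∂P ≤
      ∫⁻ p, F p * ENNReal.ofReal (x i / x (n + 1)) ^ (p.1 (rayVertex p.2 n) - 1) ∂P := by
  induction k with
  | zero =>
    refine le_of_eq (lintegral_congr fun p => ?_)
    rw [card_Gen_succ]; simp [Gen]
  | succ k ih =>
    refine le_trans ?_ ih
    have e : n + 1 + (k + 1) = n + (k + 1) + 1 := by ring
    have hxp := (hx (n + (k + 1) + 1)).1
    refine spine_super a b (a_nonneg q hq x hx a hae) (b_nonneg q hq hq0 hs hs1 hm x hx b hbe)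
      (b_zero q hq0 x b hbe) (a_sum q hq hs x hx hrec a hae) (b_sum q hq hq0 hs hs1 hm x hx b hbe)
      P hP n (k + 1) F ?_ _ _ ?_ ?_
    · intro p p' h
      refine hF p p' ⟨fun v hv => h.1 v (by omega), fun j hj => h.2 j (by omega)⟩
    · rw [ENNReal.ofReal_le_one, e, div_le_one hxp]
      exact hmono (by omega)
    · have h1 : x (i + (k + 1)) / x (n + 1 + (k + 1)) * x (n + (k + 1) + 1) = x (i + k + 1) := by
        rw [e, div_mul_cancel₀ _ hxp.ne']; rfl
      rw [a_gen q hq hs x hx hrec a hae (n + (k + 1)) _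
        (div_nonneg (hx _).1.le (hx _).1.le) (by rw [h1]; exact (hx _).2.le), h1, hrec]
      have e2 : n + (k + 1) = n + 1 + k := by ring
      rw [e2]

include hq hm hmd hm1 hc hr hx hxc hbe hq0 hs hs1 in
lemma sum_pBn (hX : ∑' ℓ : ℕ, ENNReal.ofReal (q ℓ * (ℓ : ℝ) * Real.log ℓ) = ⊤)
    (β : ℝ) (hβ0 : 0 < β) (hβ : β < Real.log m) :
    ∑' n : ℕ, ∑' ℓ : ℕ, ENNReal.ofReal (b n ℓ) * (if Real.exp (β * n) ≤ (ℓ : ℝ) then 1 else 0) = ⊤ := by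
  obtain ⟨β', hb1, hb2⟩ := exists_between hβ
  have hβ'0 : 0 < β' := hβ0.trans hb1
  have hcl := (tendsto_add_atTop_nat 1).eventually (c_lower m hm1 c hc hr β' hb2)
  obtain ⟨n0, hn0⟩ := eventually_atTop.1 hcl
  set w : ℕ → ENNReal := fun ℓ => ENNReal.ofReal (q ℓ * ℓ) with hw
  set K : ENNReal := ENNReal.ofReal (Real.exp (-1) / m) with hK
  have hK0 : K ≠ 0 := by
    rw [hK]; simp only [ne_eq, ENNReal.ofReal_eq_zero, not_le]
    have := Real.exp_pos (-1); positivity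
  have hterm : ∀ n ℓ : ℕ, K * (w ℓ * (if n0 ≤ n ∧ Real.exp (β * n) ≤ (ℓ : ℝ) ∧ (ℓ : ℝ) ≤ Real.exp (β' * n)
      then 1 else 0)) ≤ ENNReal.ofReal (b n ℓ) * (if Real.exp (β * n) ≤ (ℓ : ℝ) then 1 else 0) := by
    intro n ℓ
    split_ifs with h1 h2 h2
    · simp only [mul_one]
      rw [hK, hw, ← ENNReal.ofReal_mul (by have := Real.exp_pos (-1); positivity)]
      refine ENNReal.ofReal_le_ofReal ?_
      rw [hbe]
      have hcn : Real.exp (β' * n) ≤ c (n + 1) := by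
        refine le_trans (Real.exp_le_exp.2 ?_) (hn0 n h1.1)
        push_cast; nlinarith
      have hd := dq_pos q hq hq0 hs hs1 hm _ (hx (n + 1)).1 (hx (n + 1)).2.le
      have hd2 : dq q (x (n + 1)) ≤ m := hmd ▸ dq_le q hq hm _ (hx (n + 1)).1.le (hx (n + 1)).2.le
      have hpow : Real.exp (-1) ≤ x (n + 1) ^ (ℓ - 1) := by
        rw [hxc, ← Real.exp_nat_mul]
        refine Real.exp_le_exp.2 ?_
        have : ((ℓ - 1 : ℕ) : ℝ) ≤ c (n + 1) := by
          refine le_trans ?_ (h1.2.2.trans hcn)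
          exact_mod_cast Nat.sub_le _ _
        have : ((ℓ - 1 : ℕ) : ℝ) / c (n + 1) ≤ 1 := (div_le_one (hc _)).2 this
        have e : ((ℓ - 1 : ℕ) : ℝ) * -(1 / c (n + 1)) = -(((ℓ - 1 : ℕ) : ℝ) / c (n + 1)) := by ring
        rw [e]; linarith
      have hqℓ : 0 ≤ q ℓ * ℓ := mul_nonneg (hq ℓ) (Nat.cast_nonneg _)
      calc Real.exp (-1) / m * (q ℓ * ℓ) = (q ℓ * ℓ) * Real.exp (-1) / m := by ring
        _ ≤ (q ℓ * ℓ) * x (n + 1) ^ (ℓ - 1) / dq q (x (n + 1)) := by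
          apply div_le_div₀ _ _ hd hd2
          · exact mul_nonneg hqℓ (pow_nonneg (hx _).1.le _)
          · gcongr
        _ = _ := by ring
    · exact absurd h1.2.1 h2
    · simp
    · simp
  set N : ℕ → ENNReal := fun ℓ => ∑' n : ℕ,
    (if n0 ≤ n ∧ Real.exp (β * n) ≤ (ℓ : ℝ) ∧ (ℓ : ℝ) ≤ Real.exp (β' * n) then 1 else 0) with hN
  set κ := 1 / β - 1 / β' with hκ
  have hκ0 : 0 < κ := by
    rw [hκ]; have := one_div_lt_one_div_of_lt hβ0 hb1; linarith
  have hNb : ∀ ℓ : ℕ, ENNReal.ofReal (κ * Real.log ℓ) ≤ N ℓ + (n0 + 1 : ℕ) := by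
    intro ℓ
    rcases Nat.eq_zero_or_pos ℓ with rfl | hℓ
    · simp
    have hℓ' : (0 : ℝ) < ℓ := by exact_mod_cast hℓ
    have hlog : 0 ≤ Real.log ℓ := Real.log_nonneg (by exact_mod_cast hℓ)
    set lo := max n0 ⌈Real.log ℓ / β'⌉₊ with hlo
    set hi := ⌊Real.log ℓ / β⌋₊ with hhi
    have h1 : ((hi + 1 - lo : ℕ) : ENNReal) ≤ N ℓ := by
      calc ((hi + 1 - lo : ℕ) : ENNReal) = ∑ n ∈ Finset.Icc lo hi, (1 : ENNReal) := by simp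
        _ = ∑ n ∈ Finset.Icc lo hi, (if n0 ≤ n ∧ Real.exp (β * n) ≤ (ℓ : ℝ) ∧
              (ℓ : ℝ) ≤ Real.exp (β' * n) then (1 : ENNReal) else 0) := by
          refine Finset.sum_congr rfl fun n hn => ?_
          rw [Finset.mem_Icc] at hn
          rw [if_pos]
          refine ⟨(le_max_left _ _).trans hn.1, ?_, ?_⟩
          · have : (n : ℝ) ≤ Real.log ℓ / β := (Nat.le_floor_iff (by positivity)).1 hn.2
            rw [le_div_iff₀ hβ0] at this
            rw [← Real.le_log_iff_exp_le hℓ']; linarith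
          · have : Real.log ℓ / β' ≤ n := Nat.ceil_le.1 ((le_max_right _ _).trans hn.1)
            rw [div_le_iff₀ hβ'0] at this
            rw [← Real.log_le_iff_le_exp hℓ']; linarith
        _ ≤ N ℓ := ENNReal.sum_le_tsum _
    have h2 : κ * Real.log ℓ ≤ ((hi + 1 - lo + (n0 + 1) : ℕ) : ℝ) := by
      have a1 : Real.log ℓ / β < hi + 1 := Nat.lt_floor_add_one _
      have a2 : (⌈Real.log ℓ / β'⌉₊ : ℝ) < Real.log ℓ / β' + 1 := Nat.ceil_lt_add_one (by positivity)
      have a3 : (hi + 1 : ℕ) ≤ (hi + 1 - lo) + (n0 + ⌈Real.log ℓ / β'⌉₊) := by omega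
      have a4 : ((hi : ℝ) + 1) ≤ ((hi + 1 - lo : ℕ) : ℝ) + (n0 + ⌈Real.log ℓ / β'⌉₊) := by
        exact_mod_cast a3
      have a5 : κ * Real.log ℓ = Real.log ℓ / β - Real.log ℓ / β' := by rw [hκ]; ring
      rw [Nat.cast_add, a5]
      push_cast
      linarith
    calc ENNReal.ofReal (κ * Real.log ℓ) ≤ ENNReal.ofReal ((hi + 1 - lo + (n0 + 1) : ℕ) : ℝ) :=
          ENNReal.ofReal_le_ofReal h2
      _ = ((hi + 1 - lo : ℕ) : ENNReal) + (n0 + 1 : ℕ) := by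
        rw [ENNReal.ofReal_natCast, Nat.cast_add]
      _ ≤ _ := by gcongr
  have hwfin : ∑' ℓ, w ℓ ≠ ⊤ := by
    have : Summable (fun ℓ : ℕ => q ℓ * (ℓ : ℝ)) := by simpa [mul_comm] using hm
    exact this.tsum_ofReal_ne_top
  have hbig : ∑' ℓ, w ℓ * N ℓ = ⊤ := by
    have h1 : ENNReal.ofReal κ * ∑' ℓ : ℕ, ENNReal.ofReal (q ℓ * (ℓ : ℝ) * Real.log ℓ) ≤
        ∑' ℓ, w ℓ * N ℓ + (∑' ℓ, w ℓ) * (n0 + 1 : ℕ) := by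
      rw [← ENNReal.tsum_mul_left, ← ENNReal.tsum_mul_right, ← ENNReal.tsum_add]
      refine ENNReal.tsum_le_tsum fun ℓ => ?_
      rw [← mul_add, ← ENNReal.ofReal_mul hκ0.le]
      calc ENNReal.ofReal (κ * (q ℓ * ℓ * Real.log ℓ))
          = w ℓ * ENNReal.ofReal (κ * Real.log ℓ) := by
            rw [hw, ← ENNReal.ofReal_mul (mul_nonneg (hq ℓ) (Nat.cast_nonneg _))]
            congr 1; ring
        _ ≤ _ := by gcongr; exact hNb ℓ
    rw [hX, ENNReal.mul_top (by simpa using hκ0), top_le_iff, ENNReal.add_eq_top] at h1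
    rcases h1 with h | h
    · exact h
    · exact absurd h (ENNReal.mul_ne_top hwfin (ENNReal.natCast_ne_top _))
  refine top_le_iff.1 ?_
  calc (⊤ : ENNReal) = K * ∑' ℓ, w ℓ * N ℓ := by rw [hbig, ENNReal.mul_top hK0]
    _ = ∑' ℓ, ∑' n : ℕ, K * (w ℓ * (if n0 ≤ n ∧ Real.exp (β * n) ≤ (ℓ : ℝ) ∧
          (ℓ : ℝ) ≤ Real.exp (β' * n) then 1 else 0)) := by
        rw [← ENNReal.tsum_mul_left]
        refine tsum_congr fun ℓ => ?_
        rw [ENNReal.tsum_mul_left, ENNReal.tsum_mul_left]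
    _ = _ := ENNReal.tsum_comm
    _ ≤ _ := ENNReal.tsum_le_tsum fun n => ENNReal.tsum_le_tsum fun ℓ => hterm n ℓ

include hq hm hmd hm1 hc hr hx hxc hbe hq0 hs hs1 hrec hae hP in
lemma Bn_io (hX : ∑' ℓ : ℕ, ENNReal.ofReal (q ℓ * (ℓ : ℝ) * Real.log ℓ) = ⊤)
    (β : ℝ) (hβ0 : 0 < β) (hβ : β < Real.log m) :
    ∀ᵐ p ∂P, ∃ᶠ n in atTop, p ∈ Bn β n := by
  have hPp := hP.1
  have ha := a_nonneg q hq x hx a hae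
  have hb := b_nonneg q hq hq0 hs hs1 hm x hx b hbe
  have hb0 := b_zero q hq0 x b hbe
  have has := a_sum q hq hs x hx hrec a hae
  have hbs := b_sum q hq hq0 hs hs1 hm x hx b hbe
  have hval := ae_valid a b ha hb hb0 has hbs P hP
  set rE : ℕ → ENNReal := fun n =>
    ∑' ℓ : ℕ, ENNReal.ofReal (b n ℓ) * (if Real.exp (β * n) ≤ (ℓ : ℝ) then 1 else 0) with hrE
  have hsum : ∑' n, rE n = ⊤ := sum_pBn q hq hq0 hs hs1 hm m hmd hm1 x c hx hc hxc hr b hbe hX β hβ0 hβ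
  have hr1 : ∀ n, rE n ≤ 1 := fun n => by
    rw [← hbs n]
    refine ENNReal.tsum_le_tsum fun ℓ => ?_
    split_ifs <;> simp
  have hrt : ∀ n, rE n ≠ ⊤ := fun n => ne_top_of_le_ne_top ENNReal.one_ne_top (hr1 n)
  have hcompl : ∀ n, ∑' ℓ : ℕ, ENNReal.ofReal (b n ℓ) * (if Real.exp (β * n) ≤ (ℓ : ℝ) then 0 else 1)
      ≤ ENNReal.ofReal (Real.exp (-(rE n).toReal)) := by
    intro n
    have h1 : ∑' ℓ : ℕ, ENNReal.ofReal (b n ℓ) * (if Real.exp (β * n) ≤ (ℓ : ℝ) then 0 else 1) + rE n = 1 := by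
      refine Eq.trans ?_ (hbs n)
      rw [hrE, ← ENNReal.tsum_add]
      refine tsum_congr fun ℓ => ?_
      split_ifs <;> simp
    have h2 := ENNReal.eq_sub_of_add_eq (hrt n) h1
    rw [h2, ← ENNReal.ofReal_toReal (hrt n), ← ENNReal.ofReal_one,
      ← ENNReal.ofReal_sub _ ENNReal.toReal_nonneg, ENNReal.toReal_ofReal ENNReal.toReal_nonneg]
    refine ENNReal.ofReal_le_ofReal ?_
    have := Real.add_one_le_exp (-(rE n).toReal)
    linarith
  have hnot : ¬ Summable (fun n => (rE n).toReal) := by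
    intro h
    have := h.tsum_ofReal_ne_top
    simp_rw [ENNReal.ofReal_toReal (hrt _)] at this
    exact this hsum
  -- probability of avoiding
  have hE : ∀ N k, P {p | ∀ n, N ≤ n → n < N + k → p ∉ Bn β n} ≤
      ENNReal.ofReal (Real.exp (-∑ i ∈ Finset.range k, (rE (N + i)).toReal)) := by
    intro N k
    induction k with
    | zero => simpa using prob_le_one (μ := P)
    | succ k ih =>
      set E := {p : Om | ∀ n, N ≤ n → n < N + k → p ∉ Bn β n} with hEdef
      have hEdet : ∀ p p', p' ∈ Atom (N + k) p → (p' ∈ E ↔ p ∈ E) := by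
        intro p p' h
        simp only [hEdef, Set.mem_ofPred_eq]
        refine forall_congr' fun n => forall_congr' fun _ => forall_congr' fun hn => ?_
        rw [Bn_det β n (N + k) hn p p' h]
      rw [Finset.sum_range_succ, neg_add, Real.exp_add, ENNReal.ofReal_mul (Real.exp_pos _).le]
      exact Bn_step a b ha hb hb0 has hbs P hP β N k E hEdef hEdet _ (hcompl (N + k)) _ ih
  have hnull : ∀ N, P {p | ∀ n, N ≤ n → p ∉ Bn β n} = 0 := by
    intro N
    have hns : ¬ Summable (fun i => (rE (N + i)).toReal) := by
      intro h
      apply hnot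
      rw [← summable_nat_add_iff N]
      simpa [add_comm] using h
    have htend := (not_summable_iff_tendsto_nat_atTop_of_nonneg
      (fun i => ENNReal.toReal_nonneg)).1 hns
    have h0 : Tendsto (fun k => ENNReal.ofReal (Real.exp (-∑ i ∈ Finset.range k, (rE (N + i)).toReal)))
        atTop (nhds 0) := by
      have := ENNReal.tendsto_ofReal (Real.tendsto_exp_neg_atTop_nhds_zero.comp htend)
      simpa [Function.comp_def] using this
    refine le_antisymm (ge_of_tendsto' h0 fun k => ?_) bot_le
    refine le_trans (measure_mono ?_) (hE N k)
    intro p hp n h1 _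
    exact hp n h1
  have hall : ∀ᵐ p ∂P, ∀ N, ¬ ∀ n, N ≤ n → p ∉ Bn β n := by
    rw [ae_all_iff]
    intro N
    rw [ae_iff]
    simpa only [not_not] using hnull N
  filter_upwards [hall] with p hp
  rw [frequently_atTop]
  intro N
  have := hp N
  push Not at this
  exact this
end main

set_option linter.unusedSectionVars false

lemma lim_det (m : ℝ) (hm1 : 1 < m) (x c : ℕ → ℝ) (hc : ∀ n, 0 < c n)
    (hxc : ∀ n, x n = Real.exp (-(1 / c n)))
    (hr : Tendsto (fun n => c (n + 1) / c n) atTop (nhds m)) (z : ℕ → ℕ) (hz : ∀ k, 1 ≤ z k) (W : ℝ)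
    (hW : Tendsto (fun k => (z k : ℝ) / c k) atTop (nhds W)) (i j : ℕ) :
    Tendsto (fun k => ENNReal.ofReal (x (i + k) / x (j + k)) ^ (z (k + 1) - 1)) atTop
      (nhds (ENNReal.ofReal (Real.exp (-(W * ((m ^ i)⁻¹ * m) - W * ((m ^ j)⁻¹ * m)))))) := by
  have hci := c_tendsto m hm1 c hc hr
  have key : ∀ d : ℕ, Tendsto (fun k => ((z (k + 1) - 1 : ℕ) : ℝ) * (1 / c (d + k))) atTop
      (nhds (W * ((m ^ d)⁻¹ * m))) := by
    intro d
    have h1 := hW.comp (tendsto_add_atTop_nat 1)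
    have h2 := (c_shift m hm1 c hc hr d).mul hr
    have h3 : Tendsto (fun k => 1 / c (k + d)) atTop (nhds 0) :=
      (tendsto_const_nhds.div_atTop hci).comp (tendsto_add_atTop_nat d)
    have h4 := (h1.mul h2).sub h3
    rw [sub_zero] at h4
    refine h4.congr fun k => ?_
    simp only [Function.comp_apply]
    rw [Nat.cast_sub (hz _), add_comm d k]
    have e1 := (hc k).ne'
    have e2 := (hc (k + 1)).ne'
    have e3 := (hc (k + d)).ne'
    field_simp
    push_cast
    ring
  have h := ENNReal.tendsto_ofReal ((Real.continuous_exp.tendsto _).comp ((key i).sub (key j)).neg)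
  refine h.congr fun k => ?_
  rw [← ENNReal.ofReal_pow (by rw [hxc, hxc]; positivity)]
  simp only [Function.comp_apply]
  congr 1
  rw [hxc, hxc, ← Real.exp_sub, ← Real.exp_nat_mul]
  congr 1; ring

section main
variable (q : ℕ → ℝ) (hq : ∀ ℓ, 0 ≤ q ℓ) (hq0 : q 0 = 0) (hs : Summable q) (hs1 : ∑' ℓ, q ℓ = 1)
  (hm : Summable (fun ℓ : ℕ => (ℓ : ℝ) * q ℓ)) (m : ℝ) (hmd : m = ∑' ℓ : ℕ, (ℓ : ℝ) * q ℓ) (hm1 : 1 < m)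
  (x c : ℕ → ℝ) (hx : ∀ n, x n ∈ Set.Ioo (0 : ℝ) 1) (hrec : ∀ n, fq q (x (n + 1)) = x n)
  (hc : ∀ n, 0 < c n) (hxc : ∀ n, x n = Real.exp (-(1 / c n)))
  (hr : Tendsto (fun n => c (n + 1) / c n) atTop (nhds m)) (hmono : Monotone x)
  (a b : ℕ → ℕ → ℝ) (hae : ∀ k ℓ, a k ℓ = q ℓ * x (k + 1) ^ ℓ / x k)
  (hbe : ∀ k ℓ, b k ℓ = q ℓ * ((ℓ : ℝ) * x (k + 1) ^ (ℓ - 1)) / dq q (x (k + 1)))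
  (P : Measure Om) (hP : IsSpineLaw a b P)

/-- test functions -/
def Fnk (x : ℕ → ℝ) (β : ℝ) (i n k : ℕ) (p : Om) : ENNReal :=
  (Bn β n).indicator 1 p * ENNReal.ofReal (x (i + k) / x (n + 1 + k)) ^
        ((Gen p.1 (rayVertex p.2 n) (k + 1)).card - 1)

lemma ind_det (β : ℝ) (n j : ℕ) (hj : n < j) (p p' : Om) (h : p' ∈ Atom j p) :
    (Bn β n).indicator (1 : Om → ENNReal) p' = (Bn β n).indicator (1 : Om → ENNReal) p := by
  classical
  simp only [Set.indicator_apply, Bn_det β n j hj p p' h, Pi.one_apply]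

lemma Fnk_meas (x : ℕ → ℝ) (β : ℝ) (i n k : ℕ) : Measurable (Fnk x β i n k) := by
  refine measurable_of_atom (n + k + 1) _ fun p p' h => ?_
  unfold Fnk
  rw [ind_det β n (n + k + 1) (by omega) p p' h, Atom.ray h n (by omega)]
  by_cases hp : p ∈ Bn β n
  · rw [Atom.gen h _ hp.1 (k + 1) (by rw [rayVertex_length]; omega)]
  · simp [hp]

include hq hq0 hs hs1 hm hx hrec hae hbe hP hc hxc hmono in
lemma Fnk_int (β : ℝ) (i n : ℕ) (hin : i ≤ n + 1)
    (hb : (n : ℝ) ≤ (Real.exp (β * n) - 1) * (1 / c i - 1 / c (n + 1))) (k : ℕ) :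
    ∫⁻ p, Fnk x β i n k p ∂P ≤ ENNReal.ofReal (Real.exp (-(n : ℝ))) := by
  have hPp := hP.1
  refine (super_all q hq hq0 hs hs1 hm x hx hrec a b hae hbe P hP n i hin hmono
    ((Bn β n).indicator 1) (ind_det β n (n + 1) (by omega)) k).trans ?_
  calc _ ≤ ∫⁻ _, ENNReal.ofReal (Real.exp (-(n : ℝ))) ∂P := by
        refine lintegral_mono fun p => ?_
        by_cases hp : p ∈ Bn β n
        · simp only [Set.indicator_of_mem hp, Pi.one_apply, one_mul]
          rw [← ENNReal.ofReal_pow (div_nonneg (hx _).1.le (hx _).1.le)]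
          refine ENNReal.ofReal_le_ofReal ?_
          rw [hxc, hxc, ← Real.exp_sub, ← Real.exp_nat_mul, Real.exp_le_exp]
          have hci : 0 ≤ 1 / c i - 1 / c (n + 1) := by
            have h := hmono hin
            rw [hxc, hxc, Real.exp_le_exp] at h
            linarith
          have h2 : Real.exp (β * n) - 1 ≤ ((p.1 (rayVertex p.2 n) - 1 : ℕ) : ℝ) := by
            have h3 := hp.2
            have h4 : p.1 (rayVertex p.2 n) ≤ (p.1 (rayVertex p.2 n) - 1 : ℕ) + 1 := by omega
            have h5 : (p.1 (rayVertex p.2 n) : ℝ) ≤ ((p.1 (rayVertex p.2 n) - 1 : ℕ) : ℝ) + 1 := by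
              exact_mod_cast h4
            linarith
          have := mul_le_mul_of_nonneg_right h2 hci
          linarith
        · simp [hp]
    _ = _ := by simp

include hq hm hmd hm1 hc hr hx hxc hbe hq0 hs hs1 hrec hae hP hmono in
lemma lower_g (hX : ∑' ℓ : ℕ, ENNReal.ofReal (q ℓ * (ℓ : ℝ) * Real.log ℓ) = ⊤)
    (Winf : Config → List ℕ → ℝ)
    (hWinf : ∀ᵐ p ∂P, ∀ u : List ℕ, memTree p.1 u →
      Filter.Tendsto (fun k => (Z p.1 u k : ℝ) / c k) Filter.atTop
          (nhds (Winf p.1 u)) ∧ 0 < Winf p.1 u)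
    (γ : ℝ) (hγ0 : 0 < γ) (hγ1 : γ < 1) :
    ∀ᵐ p ∂P, ∃ᶠ n : ℕ in atTop, m ^ ⌊γ * n⌋₊ ≤ m * Winf p.1 (rayVertex p.2 n) := by
  have hPp := hP.1
  have hlog : 0 < Real.log m := Real.log_pos hm1
  obtain ⟨β, hβ1, hβ2⟩ : ∃ β, γ * Real.log m < β ∧ β < Real.log m :=
    exists_between (by nlinarith)
  have hβ0 : 0 < β := lt_trans (by positivity) hβ1
  have hio := Bn_io q hq hq0 hs hs1 hm m hmd hm1 x c hx hrec hc hxc hr a b hae hbe P hP hX β hβ0 hβ2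
  have hval := ae_valid a b (a_nonneg q hq x hx a hae) (b_nonneg q hq hq0 hs hs1 hm x hx b hbe)
      (b_zero q hq0 x b hbe) (a_sum q hq hs x hx hrec a hae) (b_sum q hq hq0 hs hs1 hm x hx b hbe) P hP
  obtain ⟨n0, hn0⟩ := eventually_atTop.1 (exp_bound m c γ hγ0 hγ1 hm1 hc hr β hβ1 hβ2)
  set ii : ℕ → ℕ := fun n => ⌊γ * n⌋₊ with hii
  have hile : ∀ n, ii n ≤ n + 1 := by
    intro n
    have : ii n ≤ n := by
      refine Nat.floor_le_of_le ?_
      have : (0 : ℝ) ≤ n := Nat.cast_nonneg n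
      nlinarith
    omega
  set G : ℕ → Om → ENNReal := fun n p => liminf (fun k => Fnk x β (ii (n + n0)) (n + n0) k p) atTop with hG
  have hGm : ∀ n, Measurable (G n) := fun n => Measurable.liminf fun k => Fnk_meas x β _ _ k
  have hGi : ∀ n, ∫⁻ p, G n p ∂P ≤ ENNReal.ofReal (Real.exp (-(n : ℝ))) := by
    intro n
    refine (lintegral_liminf_le fun k => Fnk_meas x β _ _ k).trans ?_
    refine liminf_le_of_le (by isBoundedDefault) fun y hy => ?_
    obtain ⟨k, hk⟩ := hy.exists
    refine hk.trans ((Fnk_int q hq hq0 hs hs1 hm x c hx hrec hc hxc hmono a b hae hbe P hP β _ _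
      (hile _) (hn0 _ (by omega)) k).trans ?_)
    refine ENNReal.ofReal_le_ofReal (Real.exp_le_exp.2 ?_)
    push_cast
    have : (0 : ℝ) ≤ n0 := Nat.cast_nonneg _
    linarith
  have hfin : ∫⁻ p, ∑' n, G n p ∂P ≠ ⊤ := by
    rw [lintegral_tsum fun n => (hGm n).aemeasurable]
    refine ne_top_of_le_ne_top ?_ (ENNReal.tsum_le_tsum hGi)
    exact Real.summable_exp_neg_nat.tsum_ofReal_ne_top
  have hae2 := ae_lt_top (Measurable.tsum hGm) hfin
  filter_upwards [hio, hval, hWinf, hae2] with p hp hv hW hlt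
  have ht := ENNReal.tendsto_atTop_zero_of_tsum_ne_top hlt.ne
  have hev : ∀ᶠ n in atTop, G n p < ENNReal.ofReal (Real.exp (-1)) :=
    ht.eventually_lt_const (by simpa using Real.exp_pos (-1))
  have hev2 : ∀ᶠ n in atTop, liminf (fun k => Fnk x β (ii n) n k p) atTop < ENNReal.ofReal (Real.exp (-1)) := by
    obtain ⟨n1, hn1⟩ := eventually_atTop.1 hev
    refine eventually_atTop.2 ⟨n1 + n0, fun n hn => ?_⟩
    have := hn1 (n - n0) (by omega)
    simp only [hG] at this
    rwa [Nat.sub_add_cancel (by omega)] at this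
  refine (hp.and_eventually hev2).mono fun n hn => ?_
  obtain ⟨hB, hl⟩ := hn
  obtain ⟨hWt, hW0⟩ := hW _ hB.1
  set W := Winf p.1 (rayVertex p.2 n)
  have hz : ∀ k, 1 ≤ (Gen p.1 (rayVertex p.2 n) k).card := fun k =>
    Finset.card_pos.2 ⟨_, Valid.mem_gen (hv (n + k))⟩
  simp only [Z_eq_card _ _ hB.1] at hWt
  have hlim := lim_det m hm1 x c hc hxc hr _ hz W hWt (ii n) (n + 1)
  have heq : (fun k => Fnk x β (ii n) n k p) = fun k => ENNReal.ofReal (x (ii n + k) / x (n + 1 + k)) ^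
      ((Gen p.1 (rayVertex p.2 n) (k + 1)).card - 1) := by
    funext k
    simp [Fnk, hB]
  rw [heq, hlim.liminf_eq, ENNReal.ofReal_lt_ofReal_iff (Real.exp_pos _), Real.exp_lt_exp] at hl
  have hmi : 0 < m ^ (ii n) := by positivity
  have hpos : 0 < W * ((m ^ (n + 1))⁻¹ * m) := by positivity
  have h1 : 1 ≤ W * ((m ^ (ii n))⁻¹ * m) := by linarith
  calc m ^ (ii n) = m ^ (ii n) * 1 := by ring
    _ ≤ m ^ (ii n) * (W * ((m ^ (ii n))⁻¹ * m)) := by gcongr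
    _ = m * W := by field_simp

include hm1 hc hr in
lemma upper_W (p : Om) (hv : ∀ n, Valid n p) (Winf : Config → List ℕ → ℝ)
    (hW : ∀ u : List ℕ, memTree p.1 u →
      Filter.Tendsto (fun k => (Z p.1 u k : ℝ) / c k) Filter.atTop
          (nhds (Winf p.1 u)) ∧ 0 < Winf p.1 u) (n : ℕ) :
    Winf p.1 (rayVertex p.2 n) ≤ Winf p.1 [] * m ^ n := by
  have hmem := (hv n).mem n le_rfl
  have h1 := (hW _ hmem).1
  have h0 := (hW [] (memTree_nil _)).1.comp (tendsto_add_atTop_nat n)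
  have h2 := (c_shift m hm1 c hc hr n).inv₀ (by positivity)
  have h3 := h0.mul h2
  rw [inv_inv] at h3
  refine le_of_tendsto_of_tendsto' h1 h3 fun k => ?_
  simp only [Function.comp_apply]
  have hz : (Z p.1 (rayVertex p.2 n) k : ℝ) ≤ Z p.1 [] (k + n) := by
    rw [Z_eq_card _ _ hmem, Z_eq_card _ _ (memTree_nil _)]
    have := Finset.card_le_card (Gen_subset p.1 _ hmem k)
    rw [rayVertex_length, add_comm] at this
    exact_mod_cast this
  have e1 := hc k
  have e2 := hc (k + n)
  rw [inv_div, div_mul_div_comm, mul_comm (c (k + n)) (c k), mul_div_mul_right _ _ e2.ne']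
  gcongr

include hq hm hmd hm1 hc hr hx hxc hbe hq0 hs hs1 hrec hae hP hmono in
lemma main_limsup (hX : ∑' ℓ : ℕ, ENNReal.ofReal (q ℓ * (ℓ : ℝ) * Real.log ℓ) = ⊤)
    (Winf : Config → List ℕ → ℝ)
    (hWinf : ∀ᵐ p ∂P, ∀ u : List ℕ, memTree p.1 u →
      Filter.Tendsto (fun k => (Z p.1 u k : ℝ) / c k) Filter.atTop
          (nhds (Winf p.1 u)) ∧ 0 < Winf p.1 u) :
    ∀ᵐ p ∂P, limsup (fun n : ℕ => (1 / (n : ℝ)) * Real.log (Winf p.1 (rayVertex p.2 n))) atTop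
      = Real.log m := by
  have hlog : 0 < Real.log m := Real.log_pos hm1
  have hval := ae_valid a b (a_nonneg q hq x hx a hae) (b_nonneg q hq hq0 hs hs1 hm x hx b hbe)
      (b_zero q hq0 x b hbe) (a_sum q hq hs x hx hrec a hae) (b_sum q hq hq0 hs hs1 hm x hx b hbe) P hP
  have hg : ∀ k : ℕ, 0 < 1 - 1 / ((k : ℝ) + 2) ∧ 1 - 1 / ((k : ℝ) + 2) < 1 := by
    intro k
    have h2 : (0 : ℝ) ≤ k := Nat.cast_nonneg k
    have h3 : 0 < 1 / ((k : ℝ) + 2) := by positivity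
    have h4 : 1 / ((k : ℝ) + 2) < 1 := by rw [div_lt_one (by positivity)]; linarith
    constructor <;> linarith
  have hlow : ∀ᵐ p ∂P, ∀ k : ℕ, ∃ᶠ n : ℕ in atTop,
      m ^ ⌊(1 - 1 / ((k : ℝ) + 2)) * n⌋₊ ≤ m * Winf p.1 (rayVertex p.2 n) := by
    rw [ae_all_iff]
    intro k
    exact lower_g q hq hq0 hs hs1 hm m hmd hm1 x c hx hrec hc hxc hr hmono a b hae hbe P hP hX Winf hWinf
      _ (hg k).1 (hg k).2
  filter_upwards [hval, hWinf, hlow] with p hv hW hl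
  have hm0 : 0 < m := by linarith
  refine final_det _ (Real.log m) (Real.log (Winf p.1 [])) hlog ?_ ?_
  · intro n hn
    have hn' : (0 : ℝ) < n := by exact_mod_cast hn
    have h1 := upper_W m hm1 c hc hr p hv Winf hW n
    have hp1 := (hW _ ((hv n).mem n le_rfl)).2
    have hp0 := (hW [] (memTree_nil _)).2
    have h2 := Real.log_le_log hp1 h1
    rw [Real.log_mul hp0.ne' (by positivity), Real.log_pow] at h2
    have e : Real.log (Winf p.1 []) / n + Real.log m = (1 / (n : ℝ)) * (Real.log (Winf p.1 []) + n * Real.log m) := by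
      field_simp
    rw [e]
    gcongr
  · intro k
    refine ((hl k).and_eventually (eventually_gt_atTop 0)).mono fun n hn => ?_
    obtain ⟨h1, hn⟩ := hn
    have hn' : (0 : ℝ) < n := by exact_mod_cast hn
    have hp1 := (hW _ ((hv n).mem n le_rfl)).2
    have h2 := Real.log_le_log (by positivity) h1
    rw [Real.log_mul hm0.ne' hp1.ne', Real.log_pow] at h2
    have h3 := Nat.lt_floor_add_one ((1 - 1 / ((k : ℝ) + 2)) * n)
    set γ := 1 - 1 / ((k : ℝ) + 2)
    have e : γ * Real.log m - 2 * Real.log m / n = (1 / (n : ℝ)) * ((γ * n - 2) * Real.log m) := by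
      field_simp
    rw [e]
    gcongr
    nlinarith
end main

end helpers

/-- Suppose `E[ν ln ν] = ∞`. Then under the law `P` of the spine construction, almost
surely `limsup_n (1/n) ln W∞(ξ_n) = ln m`, where `ξ_n` is the spine vertex at generation
`n` and `W∞(u) = lim_k Z_k(u)/c_k`. -/
theorem limsup_log_Winf_along_spine
    (q : ℕ → ℝ) (hq_nonneg : ∀ ℓ, 0 ≤ q ℓ) (hq_zero : q 0 = 0) (hq_sum : ∑' ℓ, q ℓ = 1)
    (m : ℝ) (hm_def : m = ∑' ℓ : ℕ, (ℓ : ℝ) * q ℓ) (hm_one : 1 < m)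
    (GW : Measure Config) (hGW : IsGW q GW)
    (s : ℝ) (hs : s ∈ Set.Ioo (0 : ℝ) 1)
    (φinv : ℕ → ℝ → ℝ)
    (hφinv : ∀ n, ∀ x ∈ Set.Ioo (0 : ℝ) 1,
      φinv n x ∈ Set.Ioo (0 : ℝ) 1 ∧ pgf GW n (φinv n x) = x)
    (hφinv_left : ∀ n, ∀ y ∈ Set.Ioo (0 : ℝ) 1, φinv n (pgf GW n y) = y)
    (c : ℕ → ℝ) (hc : ∀ n, c n = -1 / Real.log (φinv n s))
    (P : Measure (Config × (ℕ → ℕ)))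
    (hP : IsSpineLaw (tq q c) (tqs q c GW φinv s) P)
    (hXlogX : ∑' ℓ : ℕ, ENNReal.ofReal (q ℓ * (ℓ : ℝ) * Real.log ℓ) = ⊤)
    (Winf : Config → List ℕ → ℝ)
    (hWinf : ∀ᵐ p ∂P, ∀ u : List ℕ, memTree p.1 u →
      Filter.Tendsto (fun k => (Z p.1 u k : ℝ) / c k) Filter.atTop
          (nhds (Winf p.1 u)) ∧
        0 < Winf p.1 u) :
    ∀ᵐ p ∂P,
      Filter.limsup (fun n : ℕ => (1 / (n : ℝ)) * Real.log (Winf p.1 (rayVertex p.2 n)))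
        Filter.atTop = Real.log m := by
  have hs' : Summable q := by
    by_contra h
    rw [tsum_eq_zero_of_not_summable h] at hq_sum
    exact zero_ne_one hq_sum
  have hm' : Summable (fun ℓ : ℕ => (ℓ : ℝ) * q ℓ) := by
    by_contra h
    rw [tsum_eq_zero_of_not_summable h] at hm_def
    linarith
  have hm1 : 1 < ∑' ℓ : ℕ, (ℓ : ℝ) * q ℓ := hm_def ▸ hm_one
  set x : ℕ → ℝ := fun n => φinv n s with hxdef
  have hx : ∀ n, x n ∈ Set.Ioo (0 : ℝ) 1 := fun n => (hφinv n s hs).1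
  have hrec : ∀ n, fq q (x (n + 1)) = x n := by
    intro n
    have h1 := fq_Ioo q hq_nonneg hq_zero hs' hq_sum hm' hm1 _ (hx (n + 1))
    have h2 := pgf_succ q hq_nonneg hs' GW hGW n (x (n + 1)) (hx _).1.le (hx _).2.le
    rw [(hφinv (n + 1) s hs).2] at h2
    have h3 := hφinv_left n _ h1
    rw [← h2] at h3
    exact h3.symm
  have hmono : Monotone x := monotone_nat_of_le_succ fun n => by
    rw [← hrec n]; exact fq_le q hq_nonneg hq_zero hs' hq_sum hm' hm1 _ (hx _).1 (hx _).2.le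
  have hlogneg : ∀ n, Real.log (x n) < 0 := fun n => Real.log_neg (hx n).1 (hx n).2
  have hcx : ∀ n, c n = -1 / Real.log (x n) := hc
  have hcpos : ∀ n, 0 < c n := fun n => by
    rw [hcx]; exact div_pos_of_neg_of_neg (by norm_num) (hlogneg n)
  have hinv : ∀ n, 1 / c n = -Real.log (x n) := fun n => by
    rw [hcx]; have := (hlogneg n).ne; field_simp
  have hxc : ∀ n, x n = Real.exp (-(1 / c n)) := fun n => by
    rw [hinv, neg_neg, Real.exp_log (hx n).1]
  have hr : Filter.Tendsto (fun n => c (n + 1) / c n) Filter.atTop (nhds m) := by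
    rw [hm_def]
    refine (log_ratio q hq_nonneg hq_zero hs' hq_sum hm' hm1 x hx hrec).congr fun n => ?_
    rw [hcx, hcx]
    have h1 := (hlogneg n).ne
    have h2 := (hlogneg (n + 1)).ne
    field_simp
  have hae : ∀ k ℓ, tq q c k ℓ = q ℓ * x (k + 1) ^ ℓ / x k := by
    intro k ℓ
    unfold tq
    have e1 : Real.exp (1 / c k) = (x k)⁻¹ := by rw [hxc k, Real.exp_neg, inv_inv]
    have e2 : Real.exp (-(ℓ : ℝ) / c (k + 1)) = x (k + 1) ^ ℓ := by
      rw [hxc (k + 1), ← Real.exp_nat_mul]; congr 1; ring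
    rw [e1, e2]
    ring
  have hbe : ∀ k ℓ, tqs q c GW φinv s k ℓ =
      q ℓ * ((ℓ : ℝ) * x (k + 1) ^ (ℓ - 1)) / dq q (x (k + 1)) := by
    intro k ℓ
    unfold tqs
    rcases Nat.eq_zero_or_pos ℓ with rfl | hℓ
    · simp
    have e2 : Real.exp (-((ℓ : ℝ) - 1) / c (k + 1)) = x (k + 1) ^ (ℓ - 1) := by
      rw [hxc (k + 1), ← Real.exp_nat_mul, Nat.cast_sub hℓ]; congr 1; push_cast; ring
    have hd := (pgf_diff q hq_nonneg hq_zero hs' hq_sum hm' hm1 GW hGW k _ (hx (k + 1))).2.2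
    have hd0 := (pgf_diff q hq_nonneg hq_zero hs' hq_sum hm' hm1 GW hGW k _ (hx k)).2.1
    have hdq := dq_pos q hq_nonneg hq_zero hs' hq_sum hm' _ (hx (k + 1)).1 (hx (k + 1)).2.le
    rw [hrec] at hd
    change _ * (deriv (pgf GW k) (x k) / deriv (pgf GW (k + 1)) (x (k + 1))) = _
    rw [e2, hd]
    have h1 := hd0.ne'
    have h2 := hdq.ne'
    field_simp
  exact main_limsup q hq_nonneg hq_zero hs' hq_sum hm' m hm_def hm_one x c hx hrec hcpos hxc hr hmono
    _ _ hae hbe P hP hXlogX Winf hWinf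

end
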